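/- Let s ∈ (0,1), μ > 0, κ ∈ ℝ, P ∈ (0, ∞), and let φ be an even, P-periodic, nonconstant solution of the steady fDP equation with wave speed μ and constant κ which is nondecreasing on (−P/2, 0), satisfies φ(x) ≤ μ for all x, and attains the maximal height φ(0) = μ. Then φ is globally s-Hölder continuous on ℝ, and there exist constants c, C, δ > 0 such that c·|x|^s ≤ μ − φ(x) ≤ C·|x|^s for all |x| ≤ δ. -/

import Mathlib

open MeasureTheory Set

/-- The Bessel kernel `K_s`. -/
noncomputable def besselKernel (s x : ℝ) : ℝ :=
  (1 / (2 * Real.sqrt Real.pi * Real.Gamma (s / 2))) *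
    ∫ t in Set.Ioi (0 : ℝ), Real.exp (-t - x ^ 2 / (4 * t)) * t ^ ((s - 3) / 2)

/-- A solution of the steady fDP equation with wave speed `μ` and constant `κ`:
a bounded continuous function satisfying the equation pointwise. -/
def IsFDPSolution (s μ κ : ℝ) (φ : ℝ → ℝ) : Prop :=
  Continuous φ ∧ (∃ M, ∀ x, |φ x| ≤ M) ∧
    ∀ x, -μ * φ x + (φ x) ^ 2 / 2 + (3 / 2) * (∫ y, besselKernel s (x - y) * (φ y) ^ 2) = κ

namespace FDP

lemma integrableOn_J {a p : ℝ} (ha : 0 < a) (hp : p < -1) :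
    IntegrableOn (fun t : ℝ => Real.exp (-a / t) * t ^ p) (Ioi 0) := by
  have h1 : IntegrableOn (fun v : ℝ => v ^ (-p - 2) * Real.exp (-a * v ^ (1:ℝ))) (Ioi 0) :=
    integrableOn_rpow_mul_exp_neg_mul_rpow (by linarith) one_pos ha
  have h2 := (integrableOn_Ioi_comp_rpow_iff' (fun v : ℝ => v ^ (-p - 2) * Real.exp (-a * v ^ (1:ℝ)))
    (p := -1) (by norm_num)).2 h1
  refine h2.congr_fun (fun t ht => ?_) measurableSet_Ioi
  have ht : 0 < t := ht
  simp only [smul_eq_mul, Real.rpow_one]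
  rw [Real.rpow_neg_one, Real.inv_rpow ht.le, ← Real.rpow_neg ht.le, ← mul_assoc,
    ← Real.rpow_add ht, mul_comm]
  congr 2
  ring

lemma J_scale {b p x : ℝ} (hx : x ≠ 0) :
    ∫ t in Ioi (0:ℝ), Real.exp (-(b * x ^ 2) / t) * t ^ p
      = |x| ^ (2 * p + 2) * ∫ t in Ioi (0:ℝ), Real.exp (-b / t) * t ^ p := by
  have hx2 : 0 < x ^ 2 := by positivity
  have hax : 0 < |x| := abs_pos.2 hx
  have h := integral_comp_mul_left_Ioi (fun t : ℝ => Real.exp (-(b * x ^ 2) / t) * t ^ p) 0 hx2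
  rw [mul_zero, smul_eq_mul] at h
  have h' : ∫ t in Ioi (0:ℝ), Real.exp (-(b * x ^ 2) / t) * t ^ p = x ^ 2 *
      ∫ τ in Ioi (0:ℝ), Real.exp (-(b * x ^ 2) / (x ^ 2 * τ)) * (x ^ 2 * τ) ^ p := by
    rw [h]; field_simp
  rw [h']
  have : ∀ τ ∈ Ioi (0:ℝ), Real.exp (-(b * x ^ 2) / (x ^ 2 * τ)) * (x ^ 2 * τ) ^ p
      = |x| ^ (2 * p) * (Real.exp (-b / τ) * τ ^ p) := by
    intro τ hτ
    have hτ : 0 < τ := hτ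
    rw [Real.mul_rpow hx2.le hτ.le, ← sq_abs x, ← Real.rpow_natCast |x| 2, ← Real.rpow_mul hax.le]
    push_cast
    rw [show -(b * |x| ^ (2:ℝ)) / (|x| ^ (2:ℝ) * τ) = -b / τ by
      have : |x| ^ (2:ℝ) ≠ 0 := (Real.rpow_pos_of_pos hax _).ne'
      field_simp]
    ring
  rw [setIntegral_congr_fun measurableSet_Ioi this, integral_const_mul, Real.rpow_add hax,
    ← sq_abs x, ← mul_assoc]
  norm_num
  left; ring

/-- The integrand. -/
noncomputable def q (s x t : ℝ) : ℝ := Real.exp (-t - x ^ 2 / (4 * t)) * t ^ ((s - 3) / 2)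

noncomputable def cst (s : ℝ) : ℝ := 1 / (2 * Real.sqrt Real.pi * Real.Gamma (s / 2))

lemma K_eq (s x : ℝ) : besselKernel s x = cst s * ∫ t in Ioi (0:ℝ), q s x t := rfl

lemma cst_pos {s : ℝ} (hs : 0 < s) : 0 < cst s := by
  unfold cst
  have := Real.Gamma_pos_of_pos (half_pos hs)
  have := Real.pi_pos
  positivity

lemma q_pos (s x : ℝ) {t : ℝ} (ht : 0 < t) : 0 < q s x t := by
  unfold q; have := Real.rpow_pos_of_pos ht ((s - 3) / 2); positivity

lemma q_meas (s : ℝ) : Measurable (fun p : ℝ × ℝ => q s p.1 p.2) := by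
  unfold q; fun_prop

lemma q_meas' (s x : ℝ) : Measurable (fun t : ℝ => q s x t) := by
  unfold q; fun_prop

lemma q_le (s x : ℝ) {t : ℝ} (ht : 0 < t) :
    q s x t ≤ Real.exp (-((1/4) * x ^ 2) / t) * t ^ ((s - 3) / 2) := by
  unfold q
  have := Real.rpow_pos_of_pos ht ((s - 3) / 2)
  gcongr
  have : x ^ 2 / (4 * t) = (1/4) * x^2 / t := by field_simp
  rw [this, neg_div]; linarith

lemma q_int {s x : ℝ} (hs : s < 1) (hx : x ≠ 0) : IntegrableOn (q s x) (Ioi 0) := by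
  have h := integrableOn_J (a := (1/4) * x ^ 2) (p := (s-3)/2) (by positivity) (by linarith)
  refine Integrable.mono' h (q_meas' s x).aestronglyMeasurable ?_
  refine (ae_restrict_iff' measurableSet_Ioi).2 (ae_of_all _ fun t ht => ?_)
  rw [Real.norm_of_nonneg (q_pos s x ht).le]
  exact q_le s x ht

lemma K_nonneg {s : ℝ} (hs : 0 < s) (x : ℝ) : 0 ≤ besselKernel s x := by
  rw [K_eq]
  exact mul_nonneg (cst_pos hs).le (setIntegral_nonneg measurableSet_Ioi fun t ht => (q_pos s x ht).le)

lemma K_even (s x : ℝ) : besselKernel s (-x) = besselKernel s x := by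
  simp [besselKernel]

lemma K_abs (s x : ℝ) : besselKernel s |x| = besselKernel s x := by
  simp [besselKernel]

lemma K_meas (s : ℝ) : Measurable (besselKernel s) := by
  have : StronglyMeasurable (fun x => ∫ t in Ioi (0:ℝ), q s x t) :=
    StronglyMeasurable.integral_prod_right (f := q s) (q_meas s).stronglyMeasurable
  exact (this.measurable.const_mul (cst s))

/-- Upper bound. -/
lemma K_le {s : ℝ} (hs : s ∈ Ioo (0:ℝ) 1) : ∃ C, 0 < C ∧ ∀ x, x ≠ 0 → besselKernel s x ≤ C * |x| ^ (s - 1) := by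
  set I := ∫ t in Ioi (0:ℝ), Real.exp (-(1/4) / t) * t ^ ((s-3)/2) with hI
  have hI0 : 0 ≤ I := setIntegral_nonneg measurableSet_Ioi fun t ht => by
    have := Real.rpow_pos_of_pos ht ((s - 3) / 2); positivity
  have hc := cst_pos hs.1
  refine ⟨cst s * I + 1, by positivity, fun x hx => ?_⟩
  have h : ∫ t in Ioi (0:ℝ), q s x t ≤ |x| ^ (2 * ((s-3)/2) + 2) * I := by
    rw [hI, ← J_scale hx]
    refine setIntegral_mono_on (q_int hs.2 hx) (integrableOn_J (by positivity) (by linarith [hs.2]))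
      measurableSet_Ioi fun t ht => ?_
    exact q_le s x ht
  rw [show 2 * ((s-3)/2) + 2 = s - 1 by ring] at h
  have h1 := Real.rpow_nonneg (abs_nonneg x) (s - 1)
  rw [K_eq]
  nlinarith [mul_le_mul_of_nonneg_left h hc.le]

/-- Integrability and mass one. -/
lemma K_integrable_mass {s : ℝ} (hs : 0 < s) :
    Integrable (besselKernel s) ∧ ∫ x, besselKernel s x = 1 := by
  have hsec : ∀ t ∈ Ioi (0:ℝ), Integrable (fun x => q s x t) ∧
      ∫ x, q s x t = 2 * Real.sqrt Real.pi * (Real.exp (-t) * t ^ (s / 2 - 1)) := by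
    intro t ht
    have ht : 0 < t := ht
    have e : (fun x => q s x t) = fun x => (Real.exp (-t) * t ^ ((s-3)/2)) *
        Real.exp (-(1/(4*t)) * x ^ 2) := by
      funext x
      unfold q
      rw [sub_eq_add_neg, Real.exp_add]
      rw [show -(x^2/(4*t)) = -(1/(4*t)) * x^2 by ring]; ring
    constructor
    · rw [e]; exact (integrable_exp_neg_mul_sq (by positivity)).const_mul _
    · rw [e, integral_const_mul, integral_gaussian]
      have : Real.pi / (1 / (4 * t)) = (2:ℝ)^2 * Real.pi * t := by field_simp; norm_num
      rw [this, Real.sqrt_mul (by positivity), Real.sqrt_mul (by positivity), Real.sqrt_sq (by norm_num),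
        Real.sqrt_eq_rpow t]
      have : t ^ (s/2-1) = t ^ ((s-3)/2) * t ^ ((1:ℝ)/2) := by
        rw [← Real.rpow_add ht]; congr 1; ring
      rw [this]; ring
  have hG : IntegrableOn (fun t : ℝ => Real.exp (-t) * t ^ (s / 2 - 1)) (Ioi 0) :=
    Real.GammaIntegral_convergent (half_pos hs)
  have hprod : Integrable (fun p : ℝ × ℝ => q s p.1 p.2) (volume.prod (volume.restrict (Ioi 0))) := by
    rw [integrable_prod_iff' (q_meas s).aestronglyMeasurable]
    constructor
    · exact (ae_restrict_iff' measurableSet_Ioi).2 (ae_of_all _ fun t ht => (hsec t ht).1)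
    · refine IntegrableOn.congr_fun (hG.const_mul (2 * Real.sqrt Real.pi)) (fun t ht => ?_) measurableSet_Ioi
      simp only
      rw [← (hsec t ht).2]
      congr 1; funext x
      exact (Real.norm_of_nonneg (q_pos s x ht).le).symm
  constructor
  · exact hprod.integral_prod_left.const_mul (cst s)
  · have : ∫ x, besselKernel s x = cst s * ∫ x, ∫ t in Ioi (0:ℝ), q s x t := by
      rw [← integral_const_mul]; rfl
    rw [this, integral_integral_swap hprod, setIntegral_congr_fun measurableSet_Ioi
      (fun t ht => (hsec t ht).2), integral_const_mul, ← Real.Gamma_eq_integral (half_pos hs), cst]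
    have := Real.Gamma_pos_of_pos (half_pos hs)
    have := Real.pi_pos
    field_simp

lemma q_anti (s : ℝ) {x y t : ℝ} (ht : 0 < t) (hx : 0 ≤ x) (hxy : x ≤ y) : q s y t ≤ q s x t := by
  unfold q
  have := Real.rpow_pos_of_pos ht ((s - 3) / 2)
  gcongr

lemma K_anti {s : ℝ} (hs : s ∈ Ioo (0:ℝ) 1) {x y : ℝ} (hx : 0 < x) (hxy : x ≤ y) :
    besselKernel s y ≤ besselKernel s x := by
  rw [K_eq, K_eq]
  refine mul_le_mul_of_nonneg_left ?_ (cst_pos hs.1).le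
  exact setIntegral_mono_on (q_int hs.2 (hx.trans_le hxy).ne') (q_int hs.2 hx.ne') measurableSet_Ioi
    fun t ht => q_anti s ht hx.le hxy

/-- Lower bound on increments near zero. -/
lemma K_diff_lower {s : ℝ} (hs : s ∈ Ioo (0:ℝ) 1) : ∃ c, 0 < c ∧ ∀ x, 0 < x → x ≤ 1 →
    c * x ^ (s - 1) ≤ besselKernel s x - besselKernel s (3 * x / 2) := by
  set g : ℝ → ℝ := fun t => q s 1 t - q s (3/2) t with hg
  have hgi : IntegrableOn g (Ioi 0) := (q_int hs.2 one_ne_zero).sub (q_int hs.2 (by norm_num))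
  have hgpos : ∀ t, 0 < t → 0 < g t := by
    intro t ht
    have := Real.rpow_pos_of_pos ht ((s - 3) / 2)
    simp only [hg, q, ← sub_mul]
    refine mul_pos (sub_pos.2 (Real.exp_lt_exp.2 ?_)) this
    have : 1 ^ 2 / (4 * t) < (3/2:ℝ)^2 / (4 * t) := by gcongr; norm_num
    linarith
  have hpos : 0 < ∫ t in Ioi (0:ℝ), g t := by
    rw [setIntegral_pos_iff_support_of_nonneg_ae _ hgi]
    · have : Ioi (0:ℝ) ⊆ Function.support g ∩ Ioi 0 := fun t ht => ⟨(hgpos t ht).ne', ht⟩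
      exact lt_of_lt_of_le (by simp) (measure_mono this)
    · exact (ae_restrict_iff' measurableSet_Ioi).2 (ae_of_all _ fun t ht => (hgpos t ht).le)
  have hc := cst_pos hs.1
  refine ⟨cst s * ∫ t in Ioi (0:ℝ), g t, by positivity, fun x hx hx1 => ?_⟩
  rw [K_eq, K_eq, ← mul_sub, ← integral_sub (q_int hs.2 hx.ne') (q_int hs.2 (by positivity)), mul_assoc]
  refine mul_le_mul_of_nonneg_left ?_ hc.le
  have hx2 : 0 < x ^ 2 := by positivity
  have h := integral_comp_mul_left_Ioi (fun t : ℝ => q s x t - q s (3 * x / 2) t) 0 hx2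
  rw [mul_zero, smul_eq_mul] at h
  have h' : ∫ t in Ioi (0:ℝ), (q s x t - q s (3 * x / 2) t) = x ^ 2 *
      ∫ τ in Ioi (0:ℝ), (q s x (x^2*τ) - q s (3 * x / 2) (x^2*τ)) := by
    rw [h]; field_simp
  have hi : IntegrableOn (fun τ => q s x (x^2*τ) - q s (3 * x / 2) (x^2*τ)) (Ioi 0) := by
    have := (integrableOn_Ioi_comp_mul_left_iff (fun t : ℝ => q s x t - q s (3 * x / 2) t) 0 hx2).2
    rw [mul_zero] at this
    exact this ((q_int hs.2 hx.ne').sub (q_int hs.2 (by positivity)))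
  rw [h']
  have key : (∫ t in Ioi (0:ℝ), g t) * x ^ (s - 3) ≤
      ∫ τ in Ioi (0:ℝ), (q s x (x^2*τ) - q s (3 * x / 2) (x^2*τ)) := by
    rw [← integral_mul_const]
    refine setIntegral_mono_on (hgi.mul_const _) hi measurableSet_Ioi fun τ hτ => ?_
    have hτ : 0 < τ := hτ
    have e1 : (x^2*τ) ^ ((s-3)/2) = x ^ (s-3) * τ ^ ((s-3)/2) := by
      rw [Real.mul_rpow hx2.le hτ.le, ← Real.rpow_natCast x 2, ← Real.rpow_mul hx.le]
      congr 2; push_cast; ring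
    have e2 : ∀ a : ℝ, q s (a * x) (x^2*τ) = Real.exp (-(x^2*τ)) * (Real.exp (- (a^2/(4*τ))) *
        (x ^ (s-3) * τ ^ ((s-3)/2))) := by
      intro a
      rw [q, e1, sub_eq_add_neg, Real.exp_add, mul_assoc]
      congr 4
      field_simp
    have e3 : ∀ a : ℝ, q s a τ = Real.exp (-τ) * (Real.exp (- (a^2/(4*τ))) * τ ^ ((s-3)/2)) := by
      intro a
      rw [q, sub_eq_add_neg, Real.exp_add, mul_assoc]
    have := e2 1
    rw [one_mul] at this
    rw [this, show 3 * x / 2 = (3/2) * x by ring, e2]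
    have hgp := hgpos τ hτ
    simp only [hg] at hgp ⊢
    rw [e3, e3] at hgp ⊢
    have hE : Real.exp (-τ) ≤ Real.exp (-(x^2*τ)) := by
      apply Real.exp_le_exp.2
      have : x^2 ≤ 1 := by nlinarith
      nlinarith
    rw [← mul_sub, ← mul_sub, ← sub_mul, ← sub_mul] at *
    have hgp' := (mul_pos_iff_of_pos_left (Real.exp_pos _)).1 hgp
    have hx3 := Real.rpow_pos_of_pos hx (s-3)
    calc _ = Real.exp (-τ) * (((Real.exp (-(1 ^ 2 / (4 * τ))) - Real.exp (-((3 / 2) ^ 2 / (4 * τ)))) * τ ^ ((s - 3) / 2)) * x ^ (s-3)) := by ring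
      _ ≤ Real.exp (-(x^2*τ)) * (((Real.exp (-(1 ^ 2 / (4 * τ))) - Real.exp (-((3 / 2) ^ 2 / (4 * τ)))) * τ ^ ((s - 3) / 2)) * x ^ (s-3)) := by
        gcongr
      _ = _ := by ring
  have e : x ^ (s - 1) = x ^ 2 * x ^ (s - 3) := by
    rw [← Real.rpow_natCast x 2, ← Real.rpow_add hx]; congr 1; push_cast; ring
  rw [e]
  nlinarith [mul_le_mul_of_nonneg_left key hx2.le]

end FDP

namespace FDP

noncomputable def rr (s x τ : ℝ) : ℝ :=
  Real.exp (-(τ + 1 / (4 * τ)) * x - ((1 - s) / 2) * Real.log x) * τ ^ ((s - 3) / 2)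

lemma rr_eq (s : ℝ) {x τ : ℝ} (hx : 0 < x) (hτ : 0 < τ) : x * q s x (x * τ) = rr s x τ := by
  unfold q rr
  have h1 : Real.exp (-(((1 - s) / 2) * Real.log x)) = x * x ^ ((s-3)/2) := by
    nth_rewrite 2 [← Real.rpow_one x]
    rw [← Real.rpow_add hx, Real.rpow_def_of_pos hx]
    congr 1; ring
  rw [Real.mul_rpow hx.le hτ.le, sub_eq_add_neg (-(τ + 1 / (4 * τ)) * x), Real.exp_add (-(τ + 1 / (4 * τ)) * x), h1,
    show -(x * τ) - x ^ 2 / (4 * (x * τ)) = -(τ + 1 / (4 * τ)) * x by field_simp; ring]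
  ring

lemma rr_int {s x : ℝ} (hs : s < 1) (hx : 0 < x) : IntegrableOn (rr s x) (Ioi 0) ∧
    ∫ t in Ioi (0:ℝ), q s x t = ∫ t in Ioi (0:ℝ), rr s x t := by
  have hi : IntegrableOn (fun τ => x * q s x (x * τ)) (Ioi 0) := by
    have := (integrableOn_Ioi_comp_mul_left_iff (q s x) 0 hx).2
    rw [mul_zero] at this
    exact (this (q_int hs hx.ne')).const_mul x
  constructor
  · exact hi.congr_fun (fun τ hτ => rr_eq s hx hτ) measurableSet_Ioi
  · rw [← setIntegral_congr_fun measurableSet_Ioi (fun τ hτ => rr_eq s hx hτ), integral_const_mul]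
    have h := integral_comp_mul_left_Ioi (q s x) 0 hx
    rw [mul_zero, smul_eq_mul] at h
    rw [h]; field_simp

lemma rr_convex {s τ : ℝ} (hs : s < 1) (hτ : 0 < τ) :
    StrictConvexOn ℝ (Ioi 0) (fun x => rr s x τ) := by
  have h1 : StrictConvexOn ℝ (Ioi 0)
      (fun x => -(τ + 1 / (4 * τ)) * x - ((1 - s) / 2) * Real.log x) := by
    refine ⟨convex_Ioi 0, fun x hx y hy hxy a b ha hb hab => ?_⟩
    have := strictConcaveOn_log_Ioi.2 hx hy hxy ha hb hab
    simp only [smul_eq_mul] at *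
    nlinarith [mul_lt_mul_of_pos_left this (show 0 < (1-s)/2 by linarith)]
  refine ⟨convex_Ioi 0, fun x hx y hy hxy a b ha hb hab => ?_⟩
  have h2 := h1.2 hx hy hxy ha hb hab
  have h3 := convexOn_exp.2 (mem_univ (-(τ + 1 / (4 * τ)) * x - ((1 - s) / 2) * Real.log x))
    (mem_univ (-(τ + 1 / (4 * τ)) * y - ((1 - s) / 2) * Real.log y)) ha.le hb.le hab
  have h4 := (Real.exp_lt_exp.2 h2).trans_le h3
  have := Real.rpow_pos_of_pos hτ ((s - 3) / 2)
  simp only [smul_eq_mul, rr] at *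
  nlinarith [mul_lt_mul_of_pos_right h4 this]

lemma K_convex {s : ℝ} (hs : s ∈ Ioo (0:ℝ) 1) : StrictConvexOn ℝ (Ioi 0) (besselKernel s) := by
  refine ⟨convex_Ioi 0, fun x hx y hy hxy a b ha hb hab => ?_⟩
  have hz : a • x + b • y ∈ Ioi (0:ℝ) := convex_Ioi (0:ℝ) hx hy ha.le hb.le hab
  have ix := rr_int hs.2 hx
  have iy := rr_int hs.2 hy
  have iz := rr_int hs.2 hz
  rw [K_eq, K_eq, K_eq, ix.2, iy.2, iz.2]
  have hpos : 0 < ∫ t in Ioi (0:ℝ), (a * rr s x t + b * rr s y t - rr s (a • x + b • y) t) := by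
    have hp : ∀ t ∈ Ioi (0:ℝ), 0 < a * rr s x t + b * rr s y t - rr s (a • x + b • y) t :=
      fun t ht => sub_pos.2 ((rr_convex hs.2 ht).2 hx hy hxy ha hb hab)
    have hI : IntegrableOn (fun t => a * rr s x t + b * rr s y t - rr s (a • x + b • y) t) (Ioi 0) :=
      (((ix.1.const_mul a).add (iy.1.const_mul b)).sub iz.1)
    rw [setIntegral_pos_iff_support_of_nonneg_ae _ hI]
    · have : Ioi (0:ℝ) ⊆ Function.support (fun t => a * rr s x t + b * rr s y t - rr s (a • x + b • y) t) ∩ Ioi 0 := fun t ht => ⟨(hp t ht).ne', ht⟩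
      exact lt_of_lt_of_le (by simp) (measure_mono this)
    · exact (ae_restrict_iff' measurableSet_Ioi).2 (ae_of_all _ fun t ht => (hp t ht).le)
  rw [integral_sub, integral_add, integral_const_mul, integral_const_mul] at hpos
  · simp only [smul_eq_mul] at *
    nlinarith [mul_pos (cst_pos hs.1) hpos]
  · exact ix.1.const_mul a
  · exact iy.1.const_mul b
  · exact (ix.1.const_mul a).add (iy.1.const_mul b)
  · exact iz.1

/-- Decay. -/
lemma K_decay {s : ℝ} (hs : s ∈ Ioo (0:ℝ) 1) : ∃ C, 0 < C ∧ ∀ x, x ≠ 0 → besselKernel s x ≤ C / x ^ 2 := by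
  have hG : IntegrableOn (fun t : ℝ => Real.exp (-t) * t ^ ((s+1)/2 - 1)) (Ioi 0) :=
    Real.GammaIntegral_convergent (by linarith [hs.1])
  set I := ∫ t in Ioi (0:ℝ), Real.exp (-t) * t ^ ((s+1)/2 - 1)
  have hI0 : 0 ≤ I := setIntegral_nonneg measurableSet_Ioi fun t ht => by
    have := Real.rpow_pos_of_pos ht ((s+1)/2 - 1); positivity
  have hc := cst_pos hs.1
  refine ⟨cst s * (4 * I) + 1, by positivity, fun x hx => ?_⟩
  have hx2 : 0 < x ^ 2 := by positivity
  have h : ∫ t in Ioi (0:ℝ), q s x t ≤ (4 / x^2) * I := by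
    rw [← integral_const_mul]
    refine setIntegral_mono_on (q_int hs.2 hx) (hG.const_mul _) measurableSet_Ioi fun t ht => ?_
    have ht : 0 < t := ht
    have e : t ^ ((s+1)/2-1) = t * t ^ ((s-3)/2) := by
      rw [← Real.rpow_one_add' ht.le] 
      · congr 1; ring
      · linarith [hs.1, hs.2]
    unfold q
    rw [e, sub_eq_add_neg, Real.exp_add]
    have h1 : Real.exp (-(x^2/(4*t))) ≤ 4 * t / x^2 := by
      rw [Real.exp_neg, inv_le_comm₀ (Real.exp_pos _) (by positivity)]
      calc (4*t/x^2)⁻¹ = x^2/(4*t) := by rw [inv_div]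
        _ ≤ _ := by linarith [Real.add_one_le_exp (x^2/(4*t))]
    have := Real.rpow_pos_of_pos ht ((s-3)/2)
    calc _ ≤ Real.exp (-t) * (4 * t / x^2) * t ^ ((s-3)/2) := by gcongr
      _ = _ := by ring
  rw [K_eq, le_div_iff₀ hx2]
  have := mul_le_mul_of_nonneg_left h hc.le
  calc _ ≤ cst s * (4 / x^2 * I) * x^2 := by gcongr
    _ = cst s * (4 * I) := by field_simp
    _ ≤ _ := by linarith

/-- `L¹` modulus of continuity. -/
lemma K_L1 {s : ℝ} (hs : s ∈ Ioo (0:ℝ) 1) : ∃ C, 0 < C ∧ ∀ x y, x ≤ y →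
    ∫ z, |besselKernel s (y - z) - besselKernel s (x - z)| ≤ C * (y - x) ^ s := by
  obtain ⟨C, hC, hK⟩ := K_le hs
  have hKi := (K_integrable_mass hs.1).1
  refine ⟨4 * C * (1 / s), by have := hs.1; positivity, fun x y hxy => ?_⟩
  set K := besselKernel s with hKdef
  set a := (y - x) / 2 with ha
  have ha0 : 0 ≤ a := by rw [ha]; linarith
  -- recentre
  have e1 : ∫ z, |K (y - z) - K (x - z)| = ∫ w, |K (w - a) - K (w + a)| := by
    rw [← integral_sub_left_eq_self (fun z => |K (y - z) - K (x - z)|) volume ((x+y)/2)]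
    congr 1; funext w
    rw [show y - ((x+y)/2 - w) = w + a by rw [ha]; ring, show x - ((x+y)/2 - w) = w - a by rw [ha]; ring,
      abs_sub_comm]
  have i1 : Integrable (fun w => K (w - a)) := hKi.comp_sub_right a
  have i2 : Integrable (fun w => K (w + a)) := hKi.comp_add_right a
  have i3 : Integrable (fun w => |K (w - a) - K (w + a)|) := (i1.sub i2).abs
  -- even
  have e2 : ∫ w, |K (w - a) - K (w + a)| = 2 * ∫ w in Ioi (0:ℝ), |K (w - a) - K (w + a)| := by
    have : ∀ w, |K (w - a) - K (w + a)| = |K (|w| - a) - K (|w| + a)| := by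
      intro w
      rcases abs_cases w with ⟨h, _⟩ | ⟨h, _⟩
      · rw [h]
      · rw [h, hKdef, ← K_even s (-w - a), ← K_even s (-w + a), abs_sub_comm]
        congr 3 <;> ring_nf
    rw [integral_congr_ae (ae_of_all _ this)]
    rw [integral_comp_abs (f := fun w => |K (w - a) - K (w + a)|)]
  have e3 : ∫ w in Ioi (0:ℝ), |K (w - a) - K (w + a)| = ∫ w in Ioi (0:ℝ), (K (w - a) - K (w + a)) := by
    refine setIntegral_congr_ae measurableSet_Ioi ?_
    have : ∀ᵐ w : ℝ, w ≠ a := by simp [ae_iff, measure_singleton]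
    filter_upwards [this] with w hwa hw
    have hw : 0 < w := hw
    refine abs_of_nonneg (sub_nonneg.2 ?_)
    rw [hKdef, ← K_abs s (w - a)]
    refine K_anti hs (abs_pos.2 (sub_ne_zero.2 hwa)) (abs_le.2 ⟨by linarith, by linarith⟩)
  have e4 : ∫ w in Ioi (0:ℝ), (K (w - a) - K (w + a)) = ∫ w in Ioc (-a) a, K w := by
    rw [integral_sub i1.integrableOn i2.integrableOn]
    have p1 : ∫ w in Ioi (0:ℝ), K (w - a) = ∫ w in Ioi (-a), K w := by
      have := (measurePreserving_sub_right (volume : Measure ℝ) a).setIntegral_preimage_emb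
        (measurableEmbedding_subRight a) K (Ioi (-a))
      rw [← this]; congr 2; ext w; simp
    have p2 : ∫ w in Ioi (0:ℝ), K (w + a) = ∫ w in Ioi a, K w := by
      have := (measurePreserving_add_right (volume : Measure ℝ) a).setIntegral_preimage_emb
        (measurableEmbedding_addRight a) K (Ioi a)
      rw [← this]; congr 2; ext w; simp
    rw [p1, p2, ← Ioc_union_Ioi_eq_Ioi (show -a ≤ a by linarith), setIntegral_union Ioc_disjoint_Ioi_same
      measurableSet_Ioi hKi.integrableOn hKi.integrableOn]
    ring
  have hii : IntervalIntegrable (fun w : ℝ => C * w ^ (s-1)) volume 0 a :=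
    (intervalIntegral.intervalIntegrable_rpow' (by linarith [hs.1])).const_mul C
  have e5 : ∫ w in Ioc (-a) a, K w = 2 * ∫ w in Ioc 0 a, K w := by
    rw [← intervalIntegral.integral_of_le (by linarith), ← intervalIntegral.integral_of_le ha0,
      ← intervalIntegral.integral_add_adjacent_intervals (b := 0) hKi.intervalIntegrable hKi.intervalIntegrable]
    have : ∫ w in (-a)..0, K w = ∫ w in (0:ℝ)..a, K w := by
      rw [← neg_zero, ← intervalIntegral.integral_comp_neg]
      simp only [hKdef, K_even, neg_zero]
    rw [this]; ring
  have e6 : ∫ w in Ioc 0 a, K w ≤ C * (a ^ s / s) := by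
    calc ∫ w in Ioc 0 a, K w ≤ ∫ w in Ioc 0 a, C * w ^ (s-1) := by
          refine setIntegral_mono_on hKi.integrableOn ((intervalIntegrable_iff_integrableOn_Ioc_of_le ha0).1 hii) measurableSet_Ioc fun w hw => ?_
          have := hK w hw.1.ne'
          rwa [abs_of_pos hw.1] at this
      _ = _ := by
          rw [← intervalIntegral.integral_of_le ha0, intervalIntegral.integral_const_mul,
            integral_rpow (Or.inl (by linarith [hs.1]))]
          simp [Real.zero_rpow hs.1.ne']
  have e7 : a ^ s ≤ (y - x) ^ s := Real.rpow_le_rpow ha0 (by rw [ha]; linarith) hs.1.le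
  rw [e1, e2, e3, e4, e5]
  calc _ ≤ 2 * (2 * (C * (a ^ s / s))) := by linarith
    _ = 4 * C * (1 / s) * a ^ s := by ring
    _ ≤ _ := by have := hs.1; gcongr

/-- second difference bound for the Gaussian. -/
lemma gauss_second {t z x y : ℝ} (ht : 0 < t) (hx : 0 ≤ x) (hxy : x ≤ y) (hz : 2 * y ≤ z) :
    |Real.exp (-(z - y)^2/(4*t)) + Real.exp (-(z + y)^2/(4*t)) - Real.exp (-(z - x)^2/(4*t))
      - Real.exp (-(z + x)^2/(4*t))| ≤
    (y - x) * (2 * y) * ((1 / (2*t) + (9/16) * z^2 / t^2) * Real.exp (-(z^2/(16 * t)))) := by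
  set g : ℝ → ℝ := fun w => Real.exp (-w^2/(4*t)) with hg
  set g1 : ℝ → ℝ := fun w => -(w / (2*t)) * Real.exp (-w^2/(4*t)) with hg1
  set g2 : ℝ → ℝ := fun w => (-(1/(2*t)) + w^2/(4*t^2)) * Real.exp (-w^2/(4*t)) with hg2
  have d0 : ∀ w, HasDerivAt g (g1 w) w := by
    intro w
    have h : HasDerivAt (fun w : ℝ => -w^2/(4*t)) (-(w/(2*t))) w := by
      have := ((hasDerivAt_pow 2 w).neg).div_const (4*t)
      convert! this using 1
      push_cast; field_simp; ring
    have := h.exp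
    simp only [hg1]; rw [mul_comm]; exact this
  have d1 : ∀ w, HasDerivAt g1 (g2 w) w := by
    intro w
    have h : HasDerivAt (fun w : ℝ => -(w/(2*t))) (-(1/(2*t))) w := ((hasDerivAt_id w).div_const (2*t)).neg
    have := h.mul (d0 w)
    convert! this using 1
    simp only [hg2, hg1, hg]
    field_simp; ring
  set M := (1 / (2*t) + (9/16) * z^2 / t^2) * Real.exp (-(z^2/(16 * t))) with hM
  have hy : 0 ≤ y := hx.trans hxy
  have b2 : ∀ w ∈ Icc (z - y) (z + y), ‖g2 w‖ ≤ M := by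
    intro w hw
    have hw1 : z / 2 ≤ w := by linarith [hw.1]
    have hw2 : w ≤ 3 * z / 2 := by linarith [hw.2]
    have hz0 : 0 ≤ z := by linarith
    rw [hg2, Real.norm_eq_abs, abs_mul, abs_of_pos (Real.exp_pos _), hM]
    have hwsq : w^2 ≤ (9/4) * z^2 := by nlinarith
    have hwsq' : z^2/4 ≤ w^2 := by nlinarith
    gcongr
    · refine (abs_add_le _ _).trans ?_
      rw [abs_neg, abs_of_nonneg (show 0 ≤ 1/(2*t) by positivity), abs_of_nonneg (show 0 ≤ w^2/(4*t^2) by positivity)]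
      have : w^2/(4*t^2) ≤ ((9/4) * z^2)/(4*t^2) := by gcongr
      have e : ((9/4) * z^2)/(4*t^2) = 9/16 * z^2/t^2 := by field_simp; ring
      linarith
    · rw [neg_div, neg_le_neg_iff]
      rw [div_le_div_iff₀ (by positivity) (by positivity)]
      nlinarith
  -- first difference of g1
  have b1 : ∀ w ∈ Icc x y, ‖g1 (z + w) - g1 (z - w)‖ ≤ M * (2 * y) := by
    intro w hw
    have hM0 : 0 ≤ M := by rw [hM]; positivity
    have := (convex_Icc (z - y) (z + y)).norm_image_sub_le_of_norm_hasDerivWithin_le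
      (f := g1) (f' := g2) (C := M) (x := z - w) (y := z + w)
      (fun v hv => (d1 v).hasDerivWithinAt) b2 ⟨by linarith [hw.2], by linarith [hw.1]⟩
      ⟨by linarith [hw.1], by linarith [hw.2]⟩
    refine this.trans ?_
    rw [show z + w - (z - w) = 2 * w by ring, Real.norm_of_nonneg (by linarith [hw.1])]
    gcongr
    exact hw.2
  have b0 := (convex_Icc x y).norm_image_sub_le_of_norm_hasDerivWithin_le
      (f := fun w => g (z + w) + g (z - w)) (f' := fun w => g1 (z + w) - g1 (z - w))
      (C := M * (2*y)) (x := x) (y := y)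
      (fun w hw => by
        have h1 : HasDerivAt (fun w => g (z + w)) (g1 (z + w)) w := by
          simpa using (d0 (z + w)).comp_const_add z w
        have h2 : HasDerivAt (fun w => g (z - w)) (-g1 (z - w)) w := (d0 (z - w)).comp_const_sub z w
        exact (h1.add h2).hasDerivWithinAt) b1 ⟨le_rfl, hxy⟩ ⟨hxy, le_rfl⟩
  rw [Real.norm_eq_abs, Real.norm_of_nonneg (by linarith : 0 ≤ y - x)] at b0
  calc _ = |g (z + y) + g (z - y) - (g (z + x) + g (z - x))| := by
        simp only [hg]; congr 1; ring
    _ ≤ _ := by linarith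

lemma K_second {s : ℝ} (hs : s ∈ Ioo (0:ℝ) 1) : ∃ C, 0 < C ∧ ∀ x y z, 0 ≤ x → x ≤ y → 0 < z → 2 * y ≤ z →
    |besselKernel s (z - y) + besselKernel s (z + y) - besselKernel s (z - x) - besselKernel s (z + x)|
      ≤ C * ((y - x) * y * z ^ (s - 3)) := by
  set I1 := ∫ t in Ioi (0:ℝ), Real.exp (-(1/16) / t) * t ^ ((s-5)/2) with hI1
  set I2 := ∫ t in Ioi (0:ℝ), Real.exp (-(1/16) / t) * t ^ ((s-7)/2) with hI2
  have hI10 : 0 ≤ I1 := setIntegral_nonneg measurableSet_Ioi fun t ht => by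
    have := Real.rpow_pos_of_pos ht ((s - 5) / 2); positivity
  have hI20 : 0 ≤ I2 := setIntegral_nonneg measurableSet_Ioi fun t ht => by
    have := Real.rpow_pos_of_pos ht ((s - 7) / 2); positivity
  have hc := cst_pos hs.1
  refine ⟨cst s * (I1 + (9/8) * I2) + 1, by positivity, fun x y z hx hxy hz hyz => ?_⟩
  have hy : 0 ≤ y := hx.trans hxy
  have n1 : z - y ≠ 0 := by intro h; linarith
  have n2 : z + y ≠ 0 := by intro h; linarith
  have n3 : z - x ≠ 0 := by intro h; linarith
  have n4 : z + x ≠ 0 := by intro h; linarith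
  simp only [K_eq]
  have m1 : IntegrableOn (fun t => q s (z - y) t + q s (z + y) t) (Ioi 0) :=
    (q_int hs.2 n1).add (q_int hs.2 n2)
  have m2 : IntegrableOn (fun t => q s (z - y) t + q s (z + y) t - q s (z - x) t) (Ioi 0) :=
    m1.sub (q_int hs.2 n3)
  rw [← mul_add, ← mul_sub, ← mul_sub, ← integral_add (q_int hs.2 n1) (q_int hs.2 n2),
    ← integral_sub m1 (q_int hs.2 n3), ← integral_sub m2 (q_int hs.2 n4),
    abs_mul, abs_of_pos hc]
  have j1 := integrableOn_J (a := (1/16) * z^2) (p := (s-5)/2) (by positivity) (by linarith [hs.2])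
  have j2 := integrableOn_J (a := (1/16) * z^2) (p := (s-7)/2) (by positivity) (by linarith [hs.2])
  have key := norm_integral_le_of_norm_le (μ := volume.restrict (Ioi 0))
    (f := fun t => q s (z - y) t + q s (z + y) t - q s (z - x) t - q s (z + x) t)
    (((j1.const_mul (1/2)).add (j2.const_mul ((9/16) * z^2))).const_mul ((y - x) * (2 * y)))
    ((ae_restrict_iff' measurableSet_Ioi).2 (ae_of_all _ fun t ht => by
      have ht : 0 < t := ht
      have e : ∀ w, q s w t = Real.exp (-t) * t ^ ((s-3)/2) * Real.exp (-w^2/(4*t)) := by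
        intro w
        rw [q, sub_eq_add_neg, Real.exp_add, neg_div]; ring
      rw [e, e, e, e, ← mul_add, ← mul_sub, ← mul_sub, Real.norm_eq_abs, abs_mul]
      have hp := Real.rpow_pos_of_pos ht ((s-3)/2)
      rw [abs_of_pos (by positivity)]
      have h5 : t ^ ((s-5)/2) = t ^ ((s-3)/2) / t := by
        rw [← Real.rpow_sub_one ht.ne']; congr 1; ring
      have h7 : t ^ ((s-7)/2) = t ^ ((s-3)/2) / t^2 := by
        rw [← Real.rpow_natCast t 2, ← Real.rpow_sub ht]; congr 1; push_cast; ring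
      have g := gauss_second ht hx hxy hyz
      have he : Real.exp (-t) ≤ 1 := Real.exp_le_one_iff.2 (by linarith)
      calc _ ≤ 1 * t ^ ((s-3)/2) * ((y - x) * (2 * y) * ((1 / (2*t) + (9/16) * z^2 / t^2) * Real.exp (-(z^2/(16 * t))))) := by
            gcongr
        _ = _ := by
            simp only [Pi.add_apply]
            rw [h5, h7, show -(1/16 * z^2)/t = -(z^2/(16*t)) by field_simp]
            field_simp))
  rw [Real.norm_eq_abs, integral_const_mul] at key
  simp only [Pi.add_apply] at key
  rw [integral_add (j1.const_mul _) (j2.const_mul _), integral_const_mul, integral_const_mul,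
    J_scale hz.ne', J_scale hz.ne', ← hI1, ← hI2, abs_of_pos hz] at key
  have e5 : z ^ (2 * ((s-5)/2) + 2) = z ^ (s-3) := by congr 1; ring
  have e7 : z ^ 2 * z ^ (2 * ((s-7)/2) + 2) = z ^ (s-3) := by
    rw [← Real.rpow_natCast z 2, ← Real.rpow_add hz]; congr 1; push_cast; ring
  have hz3 := Real.rpow_pos_of_pos hz (s-3)
  have hyx : 0 ≤ (y - x) * y := mul_nonneg (by linarith) hy
  calc _ ≤ cst s * ((y - x) * (2 * y) * (1/2 * (z ^ (2 * ((s-5)/2) + 2) * I1) + 9/16 * z^2 * (z ^ (2 * ((s-7)/2) + 2) * I2))) := by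
        gcongr
    _ = cst s * (I1 + (9/8) * I2) * ((y - x) * y * z ^ (s-3)) := by
        rw [e5, show 9/16 * z^2 * (z ^ (2 * ((s-7)/2) + 2) * I2) = 9/16 * (z^2 * z ^ (2 * ((s-7)/2) + 2)) * I2 by ring, e7]
        ring
    _ ≤ _ := by
        have : 0 ≤ (y - x) * y * z ^ (s-3) := by positivity
        nlinarith

end FDP

namespace FDP

lemma half_line {f : ℝ → ℝ} (hf : Integrable f) :
    IntegrableOn (fun z => f z + f (-z)) (Ioi 0) ∧ ∫ z, f z = ∫ z in Ioi (0:ℝ), (f z + f (-z)) := by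
  have h2 : Integrable (fun z => f (-z)) := hf.comp_neg
  refine ⟨(hf.add h2).integrableOn, ?_⟩
  rw [integral_add hf.integrableOn h2.integrableOn, integral_comp_neg_Ioi, neg_zero, add_comm]
  exact (intervalIntegral.integral_Iic_add_Ioi hf.integrableOn hf.integrableOn).symm

lemma conv_int {s : ℝ} (hs : 0 < s) {h : ℝ → ℝ} {M : ℝ} (hc : Continuous h) (hM : ∀ z, |h z| ≤ M) (x : ℝ) :
    Integrable (fun z => besselKernel s (x - z) * h z) :=
  ((K_integrable_mass hs).1.comp_sub_left x).mul_bdd hc.aestronglyMeasurable (ae_of_all _ hM)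

lemma conv_est {s : ℝ} (hs : s ∈ Ioo (0:ℝ) 1) : ∃ A, 0 < A ∧ ∀ (h : ℝ → ℝ) (M B α x y : ℝ),
    Continuous h → (∀ z, |h z| ≤ M) → (∀ z, h (-z) = h z) → 0 ≤ α → α ≤ s → 0 ≤ B →
    (∀ z, |h z| ≤ B * |z| ^ α) → 0 ≤ x → x ≤ y → 0 < y →
    |(∫ z, besselKernel s (y - z) * h z) - ∫ z, besselKernel s (x - z) * h z|
      ≤ A * B * ((y - x) ^ s * y ^ α) := by
  obtain ⟨C1, hC1, hL⟩ := K_L1 hs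
  obtain ⟨C2, hC2, hS⟩ := K_second hs
  have hs0 := hs.1
  have hs1 := hs.2
  refine ⟨2 * C1 + C2 / (2 - 2 * s), by have : 0 < 2 - 2 * s := by linarith
                                        positivity, ?_⟩
  intro h M B α x y hc hM he hα hαs hB hb hx hxy hy
  set K := besselKernel s with hK
  set T : ℝ → ℝ := fun z => K (y - z) - K (x - z) with hT
  have iy := conv_int hs.1 hc hM y
  have ix := conv_int hs.1 hc hM x
  have iT : Integrable T := ((K_integrable_mass hs.1).1.comp_sub_left y).sub
    ((K_integrable_mass hs.1).1.comp_sub_left x)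
  have iTh : Integrable (fun z => T z * h z) := by
    refine (iy.sub ix).congr (ae_of_all _ fun z => ?_)
    simp only [hT, Pi.sub_apply]; ring
  have e0 : (∫ z, K (y - z) * h z) - ∫ z, K (x - z) * h z = ∫ z, T z * h z := by
    rw [← integral_sub iy ix]; congr 1; funext z; simp only [hT]; ring
  have hr : 0 ≤ y - x := by linarith
  have hp : s + α - 3 < -1 := by linarith
  have ip : IntegrableOn (fun z : ℝ => z ^ (s + α - 3)) (Ioi (2 * y)) :=
    integrableOn_Ioi_rpow_of_lt hp (by linarith)
  have ip2 : IntegrableOn ((Ioi (2*y)).indicator fun z : ℝ => z ^ (s + α - 3)) (Ioi 0) :=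
    (ip.integrable_indicator measurableSet_Ioi).integrableOn
  obtain ⟨iA, eA⟩ := half_line iT.abs
  rw [e0, (half_line iTh).2]
  have key := norm_integral_le_of_norm_le (μ := volume.restrict (Ioi 0))
    (f := fun z => T z * h z + T (-z) * h (-z))
    ((iA.const_mul (B * (2*y)^α)).add (ip2.const_mul (C2 * ((y - x) * y) * B)))
    ((ae_restrict_iff' measurableSet_Ioi).2 (ae_of_all _ fun z hz => by
      have hz : 0 < z := hz
      have hbz := hb z
      rw [abs_of_pos hz] at hbz
      simp only [Pi.add_apply]
      rw [he, ← add_mul, Real.norm_eq_abs, abs_mul]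
      by_cases hzy : z ∈ Ioi (2 * y)
      · rw [indicator_of_mem hzy]
        have h1 := hS x y z hx hxy hz (le_of_lt hzy)
        have e1 : T z + T (-z) = K (z - y) + K (z + y) - K (z - x) - K (z + x) := by
          simp only [hT, hK]
          rw [← K_even s (y - z), ← K_even s (x - z)]
          ring_nf
        have h2 : z ^ (s + α - 3) = z ^ (s - 3) * z ^ α := by
          rw [← Real.rpow_add hz]; congr 1; ring
        rw [e1, h2]
        have h3 : 0 ≤ B * (2*y)^α * (|T z| + |T (-z)|) := by positivity
        calc _ ≤ C2 * ((y - x) * y * z ^ (s - 3)) * (B * z ^ α) := by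
              apply mul_le_mul h1 hbz (abs_nonneg _)
              have := Real.rpow_pos_of_pos hz (s-3)
              positivity
          _ = C2 * ((y - x) * y) * B * (z ^ (s - 3) * z ^ α) := by ring
          _ ≤ _ := by linarith
      · rw [indicator_of_notMem hzy, mul_zero, add_zero]
        have hzy' : z ≤ 2 * y := not_lt.1 hzy
        have h4 : |h z| ≤ B * (2*y)^α := hbz.trans (by gcongr)
        calc _ ≤ (|T z| + |T (-z)|) * (B * (2*y)^α) := by
              gcongr; exact abs_add_le _ _
          _ = _ := by ring))
  rw [Real.norm_eq_abs] at key
  refine key.trans ?_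
  simp only [Pi.add_apply]
  rw [integral_add (iA.const_mul _) (ip2.const_mul _), integral_const_mul, integral_const_mul, ← eA,
    setIntegral_indicator measurableSet_Ioi, show Ioi (0:ℝ) ∩ Ioi (2*y) = Ioi (2*y) by
      ext z; simp; intro h; linarith, integral_Ioi_rpow_of_lt hp (by linarith)]
  have hyα := Real.rpow_pos_of_pos hy α
  have hrs := Real.rpow_nonneg hr s
  have h2α : (2*y)^α ≤ 2 * y^α := by
    rw [Real.mul_rpow (by norm_num) hy.le]
    gcongr
    calc (2:ℝ)^α ≤ 2^(1:ℝ) := Real.rpow_le_rpow_of_exponent_le (by norm_num) (by linarith)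
      _ = 2 := by norm_num
  have p1 : B * (2*y)^α * ∫ z, |T z| ≤ 2 * C1 * B * ((y - x)^s * y^α) := by
    calc _ ≤ B * (2 * y^α) * (C1 * (y - x)^s) := by
          gcongr
          exact hL x y hxy
      _ = _ := by ring
  have p2 : -(2*y)^(s + α - 3 + 1)/(s + α - 3 + 1) ≤ y ^ (s + α - 2) / (2 - 2*s) := by
    rw [show s + α - 3 + 1 = -(2 - s - α) by ring, neg_div_neg_eq, show s + α - 2 = -(2 - s - α) by ring]
    have hle2 : (2*y) ^ (-(2 - s - α)) ≤ y ^ (-(2 - s - α)) :=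
      Real.rpow_le_rpow_of_nonpos hy (by linarith) (by linarith)
    have h0 := Real.rpow_pos_of_pos hy (-(2 - s - α))
    have : 0 < 2 - 2 * s := by linarith
    exact div_le_div₀ h0.le hle2 this (by linarith)
  have p3 : (y - x) * y * y ^ (s + α - 2) ≤ (y - x)^s * y^α := by
    have e1 : y * y ^ (s + α - 2) = y ^ (s - 1) * y ^ α := by
      rw [← Real.rpow_add hy]
      nth_rewrite 1 [← Real.rpow_one y]
      rw [← Real.rpow_add hy]; congr 1; ring
    rw [mul_assoc, e1, ← mul_assoc]
    gcongr
    rcases hr.eq_or_lt with h0 | h0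
    · rw [← h0]; simp [Real.zero_rpow hs0.ne']
    · have : (y - x) = (y-x)^s * (y-x)^(1-s) := by
        rw [← Real.rpow_add h0]; simp
      have h1 : (y-x)^(1-s) ≤ y^(1-s) := Real.rpow_le_rpow hr (by linarith) (by linarith)
      have h2 : y^(1-s) * y^(s-1) = 1 := by rw [← Real.rpow_add hy]; simp
      calc (y - x) * y^(s-1) = (y-x)^s * (y-x)^(1-s) * y^(s-1) := by rw [← this]
        _ ≤ (y-x)^s * y^(1-s) * y^(s-1) := by gcongr
        _ = _ := by rw [mul_assoc, h2, mul_one]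
  have h22 : 0 < 2 - 2*s := by linarith
  calc _ ≤ 2 * C1 * B * ((y - x)^s * y^α) + C2 * ((y - x) * y) * B * (y ^ (s + α - 2) / (2 - 2*s)) := by
        gcongr
    _ = 2 * C1 * B * ((y - x)^s * y^α) + C2 / (2 - 2*s) * B * ((y - x) * y * y ^ (s + α - 2)) := by ring
    _ ≤ 2 * C1 * B * ((y - x)^s * y^α) + C2 / (2 - 2*s) * B * ((y - x)^s * y^α) := by gcongr
    _ = _ := by ring

end FDP

namespace FDP

/-- Periodised kernel. -/
noncomputable def KP (s P w : ℝ) : ℝ := ∑' n : ℤ, besselKernel s (w + n * P)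

lemma KP_even (s P w : ℝ) : KP s P (-w) = KP s P w := by
  unfold KP
  rw [← (Equiv.neg ℤ).tsum_eq]
  congr 1; funext n
  rw [← K_even]; congr 1
  simp only [Equiv.neg_apply]; push_cast; ring

lemma KP_periodic (s P w : ℝ) : KP s P (w + P) = KP s P w := by
  unfold KP
  rw [← (Equiv.addRight (1:ℤ)).tsum_eq (fun n : ℤ => besselKernel s (w + n * P))]
  congr 1; funext n
  congr 1
  simp only [Equiv.coe_addRight]; push_cast; ring

lemma KP_abs (s P w : ℝ) : KP s P |w| = KP s P w := by
  rcases abs_cases w with ⟨h, _⟩ | ⟨h, _⟩ <;> rw [h]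
  exact KP_even s P w

lemma KP_reflect (s P w : ℝ) : KP s P (P - w) = KP s P w := by
  rw [sub_eq_add_neg, add_comm, KP_periodic, KP_even]

lemma KP_summable {s P w : ℝ} (hs : s ∈ Ioo (0:ℝ) 1) (hP : 0 < P) (hw : 0 < w) (hwP : w < P) :
    Summable (fun n : ℤ => besselKernel s (w + n * P)) := by
  obtain ⟨C, hC, hK⟩ := K_decay hs
  have h := ((Real.summable_one_div_int_add_rpow (w / P) 2).2 (by norm_num)).mul_left (C / P^2)
  refine Summable.of_nonneg_of_le (fun n => K_nonneg hs.1 _) (fun n => ?_) h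
  have hne : w + n * P ≠ 0 := by
    intro h0
    rcases lt_or_ge n 0 with hn | hn
    · have : (n:ℝ) ≤ -1 := by exact_mod_cast (by omega : n ≤ -1)
      nlinarith
    · have : (0:ℝ) ≤ n := by exact_mod_cast hn
      nlinarith
  refine (hK _ hne).trans (le_of_eq ?_)
  have e : w + n * P = P * (n + w / P) := by field_simp; ring
  have hne' : (n + w / P : ℝ) ≠ 0 := by
    intro h0; rw [e, h0, mul_zero] at hne; exact hne rfl
  have : |(n:ℝ) + w / P| ^ (2:ℝ) = (n + w/P)^2 := by
    rw [← sq_abs]; exact_mod_cast Real.rpow_natCast _ 2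
  rw [this, e, mul_pow]
  field_simp

lemma KP_hasSum {s P w : ℝ} (hs : s ∈ Ioo (0:ℝ) 1) (hP : 0 < P) (hw : 0 < w) (hwP : w < P) :
    HasSum (fun n : ℕ => besselKernel s (w + n * P) + besselKernel s ((n + 1) * P - w)) (KP s P w) := by
  have h := (KP_summable hs hP hw hwP).hasSum.nat_add_neg_add_one
  refine h.congr_fun ?_ |> fun h => h
  intro n
  congr 1
  rw [← K_even]; congr 1; push_cast; ring

/-- strict convexity: bringing points together lowers the sum. -/
lemma K_spread {s : ℝ} (hs : s ∈ Ioo (0:ℝ) 1) {a a' b b' : ℝ} (ha : 0 < a) (haa : a < a') (hab : a' < b)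
    (hsum : a' + b' = a + b) :
    besselKernel s a' + besselKernel s b' < besselKernel s a + besselKernel s b := by
  have hba : 0 < b - a := by linarith
  have h1 := (K_convex hs).2 (show a ∈ Ioi (0:ℝ) from ha) (show b ∈ Ioi (0:ℝ) from by
    show 0 < b; linarith) (by linarith : a < b).ne
    (show 0 < (b - a') / (b - a) by apply div_pos <;> linarith)
    (show 0 < (a' - a) / (b - a) by apply div_pos <;> linarith) (by field_simp; ring)
  have h2 := (K_convex hs).2 (show a ∈ Ioi (0:ℝ) from ha) (show b ∈ Ioi (0:ℝ) from by
    show 0 < b; linarith) (by linarith : a < b).ne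
    (show 0 < (a' - a) / (b - a) by apply div_pos <;> linarith) 
    (show 0 < (b - a') / (b - a) by apply div_pos <;> linarith) (by field_simp; ring)
  simp only [smul_eq_mul] at h1 h2
  rw [show (b - a') / (b - a) * a + (a' - a) / (b - a) * b = a' by field_simp; ring] at h1
  rw [show (a' - a) / (b - a) * a + (b - a') / (b - a) * b = b' by
    have : b' = a + b - a' := by linarith
    rw [this]; field_simp; ring] at h2
  have e : (b - a') / (b - a) + (a' - a) / (b - a) = 1 := by field_simp; ring
  calc _ < ((b - a') / (b - a) + (a' - a) / (b - a)) * (besselKernel s a + besselKernel s b) := by linarith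
    _ = _ := by rw [e, one_mul]

lemma K_spread_le {s : ℝ} (hs : s ∈ Ioo (0:ℝ) 1) {a a' b b' : ℝ} (ha : 0 < a) (haa : a ≤ a') (hab : a' ≤ b)
    (hsum : a' + b' = a + b) :
    besselKernel s a' + besselKernel s b' ≤ besselKernel s a + besselKernel s b := by
  rcases haa.eq_or_lt with h | h
  · subst h; rw [show b' = b by linarith]
  rcases hab.eq_or_lt with h' | h'
  · subst h'; rw [show b' = a by linarith, add_comm]
  exact (K_spread hs ha h h' hsum).le

lemma KP_diff {s P w w' : ℝ} (hs : s ∈ Ioo (0:ℝ) 1) (hP : 0 < P) (hw : 0 < w) (hww : w ≤ w') (hwP : w' ≤ P / 2) :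
    (besselKernel s w + besselKernel s (P - w)) - (besselKernel s w' + besselKernel s (P - w')) ≤
      KP s P w - KP s P w' := by
  have h1 := KP_hasSum hs hP hw (by linarith)
  have h2 := KP_hasSum hs hP (hw.trans_le hww) (by linarith)
  have h3 := h1.sub h2
  have := h3.summable.sum_le_tsum {0} (fun n _ => by
    refine sub_nonneg.2 (K_spread_le hs ?_ ?_ ?_ ?_)
    · positivity
    · linarith
    · linarith
    · ring)
  rw [h3.tsum_eq] at this
  simpa using this

lemma KP_anti {s P w w' : ℝ} (hs : s ∈ Ioo (0:ℝ) 1) (hP : 0 < P) (hw : 0 < w) (hww : w ≤ w') (hwP : w' ≤ P / 2) :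
    KP s P w' ≤ KP s P w := by
  have := KP_diff hs hP hw hww hwP
  have := K_spread_le hs (a := w) (a' := w') (b := P - w) (b' := P - w') hw hww (by linarith) (by ring)
  linarith

lemma KP_strict {s P w w' : ℝ} (hs : s ∈ Ioo (0:ℝ) 1) (hP : 0 < P) (hw : 0 < w) (hww : w < w') (hwP : w' ≤ P / 2) :
    KP s P w' < KP s P w := by
  have := KP_diff hs hP hw hww.le hwP
  have := K_spread hs (a := w) (a' := w') (b := P - w) (b' := P - w') hw hww (by linarith) (by ring)
  linarith

lemma KP_lower {s P : ℝ} (hs : s ∈ Ioo (0:ℝ) 1) (hP : 0 < P) : ∃ c δ, 0 < c ∧ 0 < δ ∧ ∀ x, 0 < x → x ≤ δ →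
    c * x ^ (s - 1) ≤ KP s P x - KP s P (3 * x / 2) := by
  obtain ⟨c, hc, hK⟩ := K_diff_lower hs
  set k := besselKernel s (P/2) with hk
  have hk0 : 0 ≤ k := K_nonneg hs.1 _
  -- comparison for small x
  have ht : Filter.Tendsto (fun x : ℝ => x ^ (s - 1)) (nhdsWithin 0 (Ioi 0)) Filter.atTop :=
    tendsto_rpow_neg_nhdsGT_zero (by linarith [hs.2])
  obtain ⟨δ, hδ, hδ'⟩ := (mem_nhdsGT_iff_exists_Ioc_subset.1
    (ht.eventually (Filter.eventually_ge_atTop (2 * k / c))))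
  refine ⟨c / 2, min δ (min 1 (P/3)), by positivity, by have : (0:ℝ) < δ := hδ
                                                        positivity, fun x hx hxδ => ?_⟩
  have h1 : x ≤ δ := hxδ.trans (min_le_left _ _)
  have h2 : x ≤ 1 := hxδ.trans ((min_le_right _ _).trans (min_le_left _ _))
  have h3 : x ≤ P/3 := hxδ.trans ((min_le_right _ _).trans (min_le_right _ _))
  have h4 : 2 * k / c ≤ x ^ (s-1) := hδ' ⟨hx, h1⟩
  rw [div_le_iff₀ hc] at h4
  have h5 := hK x hx h2
  have h6 := KP_diff hs hP hx (show x ≤ 3 * x / 2 by linarith) (by linarith)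
  have h7 : besselKernel s (P - 3*x/2) ≤ k := K_anti hs (by positivity) (by linarith)
  have h8 := K_nonneg hs.1 (P - x)
  nlinarith

/-- unfolding the convolution against a periodic function. -/
lemma unfold_periodic {s P a M : ℝ} (hs : s ∈ Ioo (0:ℝ) 1) (hP : 0 < P) {D : ℝ → ℝ} (hD : Continuous D)
    (hM : ∀ z, |D z| ≤ M) (hper : Function.Periodic D P) :
    ∫ z, besselKernel s (z - a) * D z = ∫ z in Ioc (-(P/2)) (P/2), KP s P (z - a) * D z := by
  set f : ℝ → ℝ := fun z => besselKernel s (z - a) * D z with hf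
  have fi : Integrable f := ((K_integrable_mass hs.1).1.comp_sub_right a).mul_bdd
    hD.aestronglyMeasurable (ae_of_all _ hM)
  have hU := iUnion_Ioc_add_zsmul hP (-(P/2))
  have tr : ∀ (g : ℝ → ℝ) (n : ℤ), ∫ z in Ioc (-(P/2) + n • P) (-(P/2) + (n+1) • P), g z
      = ∫ z in Ioc (-(P/2)) (P/2), g (z + n * P) := by
    intro g n
    have := (measurePreserving_add_right (volume : Measure ℝ) (n * P)).setIntegral_preimage_emb
        (measurableEmbedding_addRight (n * P)) g (Ioc (-(P/2) + n • P) (-(P/2) + (n+1) • P))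
    rw [← this]; congr 2; ext z; simp only [zsmul_eq_mul, mem_preimage, mem_Ioc]; push_cast
    constructor <;> rintro ⟨h1, h2⟩ <;> constructor <;> linarith
  have hs1 : ∀ g : ℝ → ℝ, Integrable g → HasSum (fun n : ℤ => ∫ z in Ioc (-(P/2)) (P/2), g (z + n * P)) (∫ z, g z) := by
    intro g hg
    have := hasSum_integral_iUnion (s := fun n : ℤ => Ioc (-(P/2) + n • P) (-(P/2) + (n+1) • P))
      (fun n => measurableSet_Ioc) (pairwise_disjoint_Ioc_add_zsmul (-(P/2)) P) (f := g) (μ := volume)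
      hg.integrableOn
    rw [hU, setIntegral_univ] at this
    simpa only [tr] using this
  have h1 := hs1 f fi
  have h2 := hs1 (fun z => ‖f z‖) fi.norm
  have h3 := hasSum_integral_of_summable_integral_norm (μ := volume.restrict (Ioc (-(P/2)) (P/2)))
    (F := fun (n : ℤ) z => f (z + n * P)) (fun n => (fi.comp_add_right (n * P)).integrableOn) h2.summable
  rw [h1.unique h3]
  congr 1; funext z
  rw [KP, ← tsum_mul_right]
  congr 1; funext n
  simp only [hf]
  rw [(hper.int_mul n) z, show z + n * P - a = z - a + n * P by ring]

lemma KP_int {s P : ℝ} (a : ℝ) (hs : s ∈ Ioo (0:ℝ) 1) (hP : 0 < P) :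
    IntegrableOn (fun z => KP s P (z - a)) (Ioc (-(P/2)) (P/2)) := by
  have h := unfold_periodic (a := a) (M := 1) (D := fun _ => 1) hs hP continuous_const (by simp) (fun _ => rfl)
  simp only [mul_one] at h
  rw [integral_sub_right_eq_self (besselKernel s) a, (K_integrable_mass hs.1).2] at h
  by_contra hc
  rw [integral_undef hc] at h
  norm_num at h

lemma fold_odd {s P a M : ℝ} (hs : s ∈ Ioo (0:ℝ) 1) (hP : 0 < P) {D : ℝ → ℝ} (hD : Continuous D)
    (hM : ∀ z, |D z| ≤ M) (hper : Function.Periodic D P) (hodd : ∀ z, D (-z) = -D z) :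
    IntegrableOn (fun z => (KP s P (z - a) - KP s P (z + a)) * D z) (Ioc 0 (P/2)) ∧
    ∫ z, besselKernel s (z - a) * D z = ∫ z in Ioc 0 (P/2), (KP s P (z - a) - KP s P (z + a)) * D z := by
  have i1 : IntegrableOn (fun z => KP s P (z - a) * D z) (Ioc (-(P/2)) (P/2)) :=
    (KP_int a hs hP).mul_bdd hD.aestronglyMeasurable.restrict (ae_of_all _ hM)
  have i2 : IntegrableOn (fun z => KP s P (z + a) * D z) (Ioc (-(P/2)) (P/2)) := by
    have : IntegrableOn (fun z => KP s P (z - -a) * D z) (Ioc (-(P/2)) (P/2)) :=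
      (KP_int (-a) hs hP).mul_bdd hD.aestronglyMeasurable.restrict (ae_of_all _ hM)
    simpa only [sub_neg_eq_add] using this
  have sub : Ioc 0 (P/2) ⊆ Ioc (-(P/2)) (P/2) := Ioc_subset_Ioc_left (by linarith)
  have j1 := i1.mono_set sub
  have j2 := i2.mono_set sub
  constructor
  · refine (j1.sub j2).congr_fun (fun z _ => ?_) measurableSet_Ioc
    simp only [Pi.sub_apply]; ring
  rw [unfold_periodic hs hP hD hM hper, ← intervalIntegral.integral_of_le (by linarith),
    ← intervalIntegral.integral_add_adjacent_intervals (b := 0)]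
  · have e : ∫ z in (-(P/2))..0, KP s P (z - a) * D z = ∫ z in (0:ℝ)..(P/2), -(KP s P (z + a) * D z) := by
      rw [← neg_zero, ← intervalIntegral.integral_comp_neg, neg_zero]
      congr 1; funext z
      rw [hodd, ← KP_even s P (z + a)]; ring_nf
    rw [e, ← intervalIntegral.integral_add, intervalIntegral.integral_of_le (by linarith)]
    · congr 1; funext z; ring
    · exact ((intervalIntegrable_iff_integrableOn_Ioc_of_le (by linarith)).2 j2).neg
    · exact (intervalIntegrable_iff_integrableOn_Ioc_of_le (by linarith)).2 j1
  · exact (intervalIntegrable_iff_integrableOn_Ioc_of_le (by linarith)).2 (i1.mono_set (Ioc_subset_Ioc_right (by linarith)))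
  · exact (intervalIntegrable_iff_integrableOn_Ioc_of_le (by linarith)).2 j1

/-- comparison of values at two points for functions decreasing/increasing on the half period -/
lemma KP_cmp {s P z a : ℝ} (hs : s ∈ Ioo (0:ℝ) 1) (hP : 0 < P) (hz : 0 < z) (hzP : z ≤ P/2) (ha : 0 < a)
    (haP : a ≤ P/2) (hne : z ≠ a) : KP s P (z + a) ≤ KP s P (z - a) := by
  rw [← KP_abs s P (z - a)]
  have h0 : 0 < |z - a| := abs_pos.2 (sub_ne_zero.2 hne)
  have h1 : |z - a| ≤ z + a := abs_le.2 ⟨by linarith, by linarith⟩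
  have h2 : |z - a| ≤ P - (z + a) := abs_le.2 ⟨by linarith, by linarith⟩
  rcases le_total (z + a) (P/2) with h | h
  · exact KP_anti hs hP h0 h1 h
  · rw [← KP_reflect s P (z + a)]
    exact KP_anti hs hP h0 h2 (by linarith)

lemma mono_cmp {P z a : ℝ} {g : ℝ → ℝ} (hge : ∀ z, g (-z) = g z) (hgp : Function.Periodic g P)
    (hgm : MonotoneOn g (Icc 0 (P/2))) (hz : 0 ≤ z) (hzP : z ≤ P/2) (ha : 0 ≤ a)
    (haP : a ≤ P/2) : g (z - a) ≤ g (z + a) := by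
  have e : g (z - a) = g |z - a| := by
    rcases abs_cases (z - a) with ⟨h, _⟩ | ⟨h, _⟩ <;> rw [h]
    rw [hge]
  rw [e]
  have h1 : |z - a| ≤ z + a := abs_le.2 ⟨by linarith, by linarith⟩
  have h2 : |z - a| ≤ P - (z + a) := abs_le.2 ⟨by linarith, by linarith⟩
  have h0 := abs_nonneg (z - a)
  rcases le_total (z + a) (P/2) with h | h
  · exact hgm ⟨h0, h1.trans h⟩ ⟨by linarith, h⟩ h1
  · have : g (z + a) = g (P - (z + a)) := by
      rw [← hge, ← hgp]; ring_nf
    rw [this]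
    exact hgm ⟨h0, by linarith⟩ ⟨by linarith, by linarith⟩ h2

lemma mono_conv {s P x M : ℝ} (hs : s ∈ Ioo (0:ℝ) 1) (hP : 0 < P) {g : ℝ → ℝ} (hg : Continuous g)
    (hM : ∀ z, |g z| ≤ M)
    (hge : ∀ z, g (-z) = g z) (hgp : Function.Periodic g P)
    (hgm : MonotoneOn g (Icc 0 (P/2))) (hx : 0 < x) (hxP : x ≤ P) :
    0 ≤ (∫ y, besselKernel s (x - y) * g y) - (∫ y, besselKernel s (0 - y) * g y) ∧
    ∀ p r, x / 2 < p → p ≤ r → r ≤ (P - x)/2 → r < p + x →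
      (r - p) * ((KP s P (r - x/2) - KP s P (p + x/2)) * (g (p + x/2) - g (r - x/2))) ≤
      (∫ y, besselKernel s (x - y) * g y) - (∫ y, besselKernel s (0 - y) * g y) := by
  set D : ℝ → ℝ := fun z => g (z + x/2) - g (z - x/2) with hD
  have hDc : Continuous D := by fun_prop
  have hDM : ∀ z, |D z| ≤ M + M := fun z => (abs_sub _ _).trans (add_le_add (hM _) (hM _))
  have hDp : Function.Periodic D P := by
    intro z
    simp only [hD]
    rw [show z + P + x/2 = z + x/2 + P by ring, show z + P - x/2 = z - x/2 + P by ring, hgp, hgp]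
  have hDo : ∀ z, D (-z) = - D z := by
    intro z
    simp only [hD]
    rw [← hge (-z + x/2), ← hge (-z - x/2)]; ring_nf
  obtain ⟨hi, he⟩ := fold_odd (a := x/2) hs hP hDc hDM hDp hDo
  have e1 : (∫ y, besselKernel s (x - y) * g y) - (∫ y, besselKernel s (0 - y) * g y)
      = ∫ z, besselKernel s (z - x/2) * D z := by
    have a1 : ∫ y, besselKernel s (x - y) * g y = ∫ z, besselKernel s (z - x/2) * g (z + x/2) := by
      rw [← integral_add_right_eq_self (fun y => besselKernel s (x - y) * g y) (x/2)]
      congr 1; funext z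
      rw [← K_even]; ring_nf
    have a2 : ∫ y, besselKernel s (0 - y) * g y = ∫ z, besselKernel s (z - x/2) * g (z - x/2) := by
      rw [← integral_sub_right_eq_self (fun y => besselKernel s (0 - y) * g y) (x/2)]
      congr 1; funext z
      rw [← K_even]; ring_nf
    have hKi := (K_integrable_mass hs.1).1.comp_sub_right (x/2)
    rw [a1, a2, ← integral_sub]
    · congr 1; funext z; simp only [hD]; ring
    · exact hKi.mul_bdd (by fun_prop : Continuous fun z => g (z + x/2)).aestronglyMeasurable (ae_of_all _ fun z => hM _)
    · exact hKi.mul_bdd (by fun_prop : Continuous fun z => g (z - x/2)).aestronglyMeasurable (ae_of_all _ fun z => hM _)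
  rw [e1, he]
  have hae : ∀ᵐ w : ℝ, w ≠ x/2 := by simp [ae_iff, measure_singleton]
  have hnn : 0 ≤ᵐ[volume.restrict (Ioc 0 (P/2))] fun z => (KP s P (z - x/2) - KP s P (z + x/2)) * D z := by
    refine (ae_restrict_iff' measurableSet_Ioc).2 ?_
    filter_upwards [hae] with z hz hz'
    exact mul_nonneg (sub_nonneg.2 (KP_cmp hs hP hz'.1 hz'.2 (by linarith) (by linarith) hz))
      (sub_nonneg.2 (mono_cmp hge hgp hgm hz'.1.le hz'.2 (by linarith) (by linarith)))
  refine ⟨integral_nonneg_of_ae hnn, fun p r hp hpr hr hrp => ?_⟩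
  have hsub : Ioc p r ⊆ Ioc 0 (P/2) := Ioc_subset_Ioc (by linarith) (by linarith)
  refine le_trans ?_ (setIntegral_mono_set hi hnn hsub.eventuallyLE)
  have : (r - p) * ((KP s P (r - x/2) - KP s P (p + x/2)) * (g (p + x/2) - g (r - x/2)))
      = ∫ z in Ioc p r, ((KP s P (r - x/2) - KP s P (p + x/2)) * (g (p + x/2) - g (r - x/2))) := by
    rw [setIntegral_const, Real.volume_real_Ioc_of_le hpr, smul_eq_mul]
  rw [this]
  refine setIntegral_mono_on (integrable_const _) (hi.mono_set hsub) measurableSet_Ioc fun z hz => ?_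
  have k1 : KP s P (r - x/2) ≤ KP s P (z - x/2) := KP_anti hs hP (by linarith [hz.1]) (by linarith [hz.2]) (by linarith)
  have k2 : KP s P (z + x/2) ≤ KP s P (p + x/2) := KP_anti hs hP (by linarith [hz.1]) (by linarith [hz.1]) (by linarith [hz.2])
  have k3 : KP s P (p + x/2) ≤ KP s P (r - x/2) := KP_anti hs hP (by linarith) (by linarith) (by linarith)
  have g1 : g (p + x/2) ≤ g (z + x/2) := hgm ⟨by linarith, by linarith⟩ ⟨by linarith [hz.1], by linarith [hz.2]⟩ (by linarith [hz.1])
  have g2 : g (z - x/2) ≤ g (r - x/2) := hgm ⟨by linarith [hz.1], by linarith [hz.2]⟩ ⟨by linarith, by linarith⟩ (by linarith [hz.2])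
  have g3 : g (r - x/2) ≤ g (p + x/2) := hgm ⟨by linarith, by linarith⟩ ⟨by linarith, by linarith⟩ (by linarith)
  simp only [hD]
  apply mul_le_mul <;> linarith

end FDP

namespace FDP

lemma cv_neg {s : ℝ} {h : ℝ → ℝ} (he : ∀ z, h (-z) = h z) (x : ℝ) :
    ∫ y, besselKernel s (-x - y) * h y = ∫ y, besselKernel s (x - y) * h y := by
  rw [← integral_neg_eq_self]
  congr 1; funext y
  rw [he, ← K_even]; ring_nf

lemma tail_conv {s M δ x : ℝ} (hs : s ∈ Ioo (0:ℝ) 1) {h : ℝ → ℝ} (hc : Continuous h)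
    (hM : ∀ z, |h z| ≤ M) (he : ∀ z, h (-z) = h z) (h0 : ∀ z, 0 ≤ h z)
    (hv : ∀ z, |z| ≤ δ → h z = 0) (hx : 0 < x) (hxδ : x < δ) :
    ∫ y, besselKernel s (0 - y) * h y ≤ ∫ y, besselKernel s (x - y) * h y := by
  have i1 := conv_int hs.1 hc hM x
  have i2 := conv_int hs.1 hc hM (-x)
  have i3 := conv_int hs.1 hc hM 0
  have e := cv_neg (s := s) he x
  have key : ∫ y, (besselKernel s (0 - y) * h y + besselKernel s (0 - y) * h y) ≤
      ∫ y, (besselKernel s (x - y) * h y + besselKernel s (-x - y) * h y) := by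
    refine integral_mono (i3.add i3) (i1.add i2) fun y => ?_
    rcases le_or_gt |y| δ with hy | hy
    · simp [hv y hy]
    · have hsp := K_spread_le hs (a := |y| - x) (a' := |y|) (b := |y| + x) (b' := |y|)
        (by linarith) (by linarith) (by linarith) (by ring)
      have e0 : besselKernel s (0 - y) = besselKernel s |y| := by
        rw [K_abs, zero_sub, K_even]
      have e1 : besselKernel s (x - y) + besselKernel s (-x - y) =
          besselKernel s (|y| - x) + besselKernel s (|y| + x) := by
        rcases abs_cases y with ⟨h, _⟩ | ⟨h, _⟩ <;> rw [h]
        · rw [← K_even s (x - y), ← K_even s (-x - y)]; ring_nf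
        · rw [add_comm]; ring_nf
      have := h0 y
      simp only []
      rw [← add_mul, ← add_mul, e1, e0]
      exact mul_le_mul_of_nonneg_right hsp this
  rw [integral_add i3 i3, integral_add i1 i2, e] at key
  linarith

lemma cv_const {s : ℝ} (hs : 0 < s) (c x : ℝ) : ∫ y, besselKernel s (x - y) * c = c := by
  rw [integral_mul_const, integral_sub_left_eq_self (besselKernel s) volume x, (K_integrable_mass hs).2, one_mul]

lemma cv_add {s M N : ℝ} (hs : 0 < s) {f g : ℝ → ℝ} (hf : Continuous f) (hM : ∀ z, |f z| ≤ M)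
    (hg : Continuous g) (hN : ∀ z, |g z| ≤ N) (x : ℝ) :
    ∫ y, besselKernel s (x - y) * (f y + g y) =
      (∫ y, besselKernel s (x - y) * f y) + ∫ y, besselKernel s (x - y) * g y := by
  rw [← integral_add (conv_int hs hf hM x) (conv_int hs hg hN x)]
  congr 1; funext y; ring

lemma cv_le {s M N : ℝ} (hs : 0 < s) {f g : ℝ → ℝ} (hf : Continuous f) (hM : ∀ z, |f z| ≤ M)
    (hg : Continuous g) (hN : ∀ z, |g z| ≤ N) (hfg : ∀ z, f z ≤ g z) (x : ℝ) :
    ∫ y, besselKernel s (x - y) * f y ≤ ∫ y, besselKernel s (x - y) * g y :=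
  integral_mono (conv_int hs hf hM x) (conv_int hs hg hN x)
    fun y => mul_le_mul_of_nonneg_left (hfg y) (K_nonneg hs _)

lemma step1 {s μ P M : ℝ} (hs : s ∈ Ioo (0:ℝ) 1) (hμ : 0 < μ) (hP : 0 < P) {φ : ℝ → ℝ}
    (hc : Continuous φ) (hM : ∀ x, |φ x| ≤ M) (he : ∀ x, φ (-x) = φ x)
    (hp : Function.Periodic φ P) (ha : AntitoneOn φ (Icc 0 (P/2))) (hle : ∀ x, φ x ≤ μ)
    (heq : ∀ x, (μ - φ x)^2 = 3 * ((∫ y, besselKernel s (0 - y) * φ y ^ 2) -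
      ∫ y, besselKernel s (x - y) * φ y ^ 2)) : -μ < φ (P/2) := by
  by_contra! hcon
  set f1 : ℝ → ℝ := fun y => min (φ y ^ 2) (μ ^ 2) with hf1
  set f2 : ℝ → ℝ := fun y => max (φ y ^ 2 - μ ^ 2) 0 with hf2
  have hsq : ∀ y, φ y ^ 2 = f1 y + f2 y := by
    intro y; simp only [hf1, hf2]
    rcases le_total (φ y ^ 2) (μ ^ 2) with h | h
    · rw [min_eq_left h, max_eq_right (by linarith)]; ring
    · rw [min_eq_right h, max_eq_left (by linarith)]; ring
  have hsM : ∀ y, φ y ^ 2 ≤ M ^ 2 := fun y => sq_le_sq' (by linarith [abs_le.1 (hM y)]) (abs_le.1 (hM y)).2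
  have c1 : Continuous f1 := by fun_prop
  have c2 : Continuous f2 := by fun_prop
  have n1 : ∀ y, 0 ≤ f1 y := fun y => by positivity
  have n2 : ∀ y, 0 ≤ f2 y := fun y => le_max_right _ _
  have l1 : ∀ y, f1 y ≤ μ ^ 2 := fun y => min_le_right _ _
  have b1 : ∀ y, |f1 y| ≤ μ ^ 2 := fun y => by rw [abs_of_nonneg (n1 y)]; exact l1 y
  have b2 : ∀ y, |f2 y| ≤ M ^ 2 := fun y => by
    rw [abs_of_nonneg (n2 y)]; exact max_le (by linarith [hsM y, sq_nonneg μ]) (sq_nonneg M)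
  have m2 : MonotoneOn f2 (Icc 0 (P/2)) := by
    intro a haa b hb hab
    have := ha haa hb hab
    have := hle a
    simp only [hf2]
    rcases le_total (φ a ^ 2) (μ ^ 2) with h | h
    · rw [max_eq_right (by linarith)]; exact le_max_right _ _
    · have hna : φ a ≤ 0 ∨ φ a = μ := by
        by_contra! hx
        have : φ a < μ := lt_of_le_of_ne (hle a) hx.2
        nlinarith
      rcases hna with hna | hna
      · apply max_le_max _ le_rfl
        nlinarith
      · rw [max_eq_right (by rw [hna]; linarith)]; exact le_max_right _ _
  have F2 := (mono_conv (x := P/2) hs hP c2 b2 (fun z => by simp only [hf2, he])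
    (fun z => by simp only [hf2]; rw [hp]) m2 (by linarith) (by linarith)).1
  have h := heq (P/2)
  simp only [hsq] at h
  rw [cv_add hs.1 c1 b1 c2 b2, cv_add hs.1 c1 b1 c2 b2] at h
  have u1 := cv_le hs.1 c1 b1 (continuous_const (y := μ ^ 2)) (N := μ^2) (fun z => by simp) l1 0
  rw [cv_const hs.1] at u1
  have u2 : 0 ≤ ∫ y, besselKernel s (P/2 - y) * f1 y := integral_nonneg fun y => mul_nonneg (K_nonneg hs.1 _) (n1 y)
  nlinarith

end FDP

namespace FDP

lemma g_pos {s P M δ : ℝ} (hs : s ∈ Ioo (0:ℝ) 1) (hP : 0 < P) (hδ : 0 < δ) {g u : ℝ → ℝ}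
    (hg : Continuous g) (hM : ∀ z, |g z| ≤ M)
    (hge : ∀ z, g (-z) = g z) (hgp : Function.Periodic g P)
    (hgm : MonotoneOn g (Icc 0 (P/2))) (g0 : g 0 = 0) (gP : 0 < g (P/2))
    (hu : ∀ x ∈ Icc 0 (P/2), g x = 0 → u x = 0)
    (hin : ∀ x, 0 < x → x < δ → 3 * ((∫ y, besselKernel s (x - y) * g y) -
      ∫ y, besselKernel s (0 - y) * g y) ≤ u x ^ 2) :
    ∀ x ∈ Ioc 0 (P/2), 0 < g x := by
  set Z : Set ℝ := Icc 0 (P/2) ∩ g ⁻¹' {0} with hZ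
  have hZc : IsCompact Z := isCompact_Icc.inter_right (isClosed_singleton.preimage hg)
  have h0Z : (0:ℝ) ∈ Z := ⟨⟨le_rfl, by linarith⟩, g0⟩
  obtain ⟨haI, haz⟩ := hZc.sSup_mem ⟨0, h0Z⟩
  set a := sSup Z with ha
  have haz' : g a = 0 := haz
  have hgt : ∀ x, a < x → x ≤ P/2 → 0 < g x := by
    intro x hx hxP
    have h1 := hgm haI ⟨haI.1.trans hx.le, hxP⟩ hx.le
    rw [haz'] at h1
    rcases h1.eq_or_lt with h | h
    · exact absurd (le_csSup hZc.bddAbove (show x ∈ Z from ⟨⟨haI.1.trans hx.le, hxP⟩, h.symm⟩)) (not_le.2 hx)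
    · exact h
  rcases haI.1.eq_or_lt with h | h
  · intro x hx
    exact hgt x (by rw [← h]; exact hx.1) hx.2
  exfalso
  have haP : a < P/2 := lt_of_le_of_ne haI.2 (fun h => by rw [h] at haz'; linarith)
  have hz : ∀ x, 0 ≤ x → x ≤ a → g x = 0 := by
    intro x hx hxa
    have h1 := hgm ⟨le_rfl, by linarith⟩ ⟨hx, by linarith⟩ hx
    have h2 := hgm ⟨hx, by linarith⟩ haI hxa
    linarith
  obtain ⟨x, hx, hxm⟩ := exists_between (show 0 < min (min a (P/2 - a)) δ by
    exact lt_min (lt_min h (by linarith)) hδ)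
  rw [lt_min_iff, lt_min_iff] at hxm
  obtain ⟨⟨hxa, hxP⟩, hxδ⟩ := hxm
  have hk := (mono_conv hs hP hg hM hge hgp hgm hx (by linarith)).2 (a - x/4) (a + x/4)
    (by linarith) (by linarith) (by linarith) (by linarith)
  have h3 := hin x hx hxδ
  rw [hu x ⟨hx.le, by linarith⟩ (hz x hx.le hxa.le)] at h3
  rw [show a + x/4 - x/2 = a - x/4 by ring, show a - x/4 + x/2 = a + x/4 by ring] at hk
  have k1 := KP_strict hs hP (w := a - x/4) (w' := a + x/4) (by linarith) (by linarith) (by linarith)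
  have k2 := hgt (a + x/4) (by linarith) (by linarith)
  have k3 := hz (a - x/4) (by linarith) (by linarith)
  have : 0 < (a + x/4 - (a - x/4)) * ((KP s P (a - x/4) - KP s P (a + x/4)) * (g (a + x/4) - g (a - x/4))) := by
    apply mul_pos (by linarith); apply mul_pos <;> linarith
  linarith

lemma g_lower {s P M δ μ : ℝ} (hs : s ∈ Ioo (0:ℝ) 1) (hP : 0 < P) (hδ : 0 < δ) (hμ : 0 < μ) {g u : ℝ → ℝ}
    (hg : Continuous g) (hM : ∀ z, |g z| ≤ M)
    (hge : ∀ z, g (-z) = g z) (hgp : Function.Periodic g P)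
    (hgm : MonotoneOn g (Icc 0 (P/2))) (hpos : ∀ x ∈ Ioc 0 (P/2), 0 < g x)
    (hu0 : ∀ x, 0 ≤ u x) (hu : ∀ x, 0 < x → x < δ → μ * u x ≤ g x)
    (hin : ∀ x, 0 < x → x < δ → 3 * ((∫ y, besselKernel s (x - y) * g y) -
      ∫ y, besselKernel s (0 - y) * g y) ≤ u x ^ 2) :
    ∃ c d, 0 < c ∧ 0 < d ∧ ∀ x, 0 < x → x ≤ d → c * x ^ s ≤ g x := by
  obtain ⟨c0, d0, hc0, hd0, hK⟩ := KP_lower hs hP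
  obtain ⟨d, hd, hdm⟩ := exists_between (show 0 < min (min d0 (P/4)) δ by
    exact lt_min (lt_min hd0 (by linarith)) hδ)
  rw [lt_min_iff, lt_min_iff] at hdm
  obtain ⟨⟨hdd, hdP⟩, hdδ⟩ := hdm
  set k : ℝ := 3/2 * c0 * μ^2 with hk
  have hkp : 0 < k := by positivity
  have hrec : ∀ x, 0 < x → x ≤ d → k * x ^ s * (g (3*x/2) - g x) ≤ g x ^ 2 := by
    intro x hx hxd
    have h1 := (mono_conv hs hP hg hM hge hgp hgm hx (by linarith)).2 x (3*x/2)
      (by linarith) (by linarith) (by linarith) (by linarith)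
    rw [show 3*x/2 - x/2 = x by ring, show x + x/2 = 3*x/2 by ring] at h1
    have h2 := hin x hx (by linarith)
    have h3 := hu x hx (by linarith)
    have h4 := hK x hx (by linarith)
    have h5 : 0 ≤ g (3*x/2) - g x := sub_nonneg.2 (hgm ⟨hx.le, by linarith⟩ ⟨by linarith, by linarith⟩ (by linarith))
    have h6 : (μ * u x)^2 ≤ g x ^ 2 := pow_le_pow_left₀ (mul_nonneg hμ.le (hu0 x)) h3 2
    have h7 : c0 * x ^ (s-1) * (g (3*x/2) - g x) ≤ (KP s P x - KP s P (3*x/2)) * (g (3*x/2) - g x) :=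
      mul_le_mul_of_nonneg_right h4 h5
    have h8 : x * x ^ (s - 1) = x ^ s := by
      rw [Real.rpow_sub_one hx.ne']; field_simp
    have h9 : x/2 * (c0 * x ^ (s-1) * (g (3*x/2) - g x)) ≤ x/2 * ((KP s P x - KP s P (3*x/2)) * (g (3*x/2) - g x)) :=
      mul_le_mul_of_nonneg_left h7 (by linarith)
    have h10 : 3 * (x/2 * (c0 * x ^ (s-1) * (g (3*x/2) - g x))) ≤ u x ^ 2 := by linarith
    calc k * x ^ s * (g (3*x/2) - g x) = μ^2 * (3 * (x/2 * (c0 * x ^ (s-1) * (g (3*x/2) - g x)))) := by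
          rw [← h8, hk]; ring
      _ ≤ μ^2 * u x ^2 := mul_le_mul_of_nonneg_left h10 (by positivity)
      _ ≤ _ := by rw [← mul_pow]; exact h6
  set q : ℝ := (3/2 : ℝ) ^ s with hq
  have hq1 : 1 < q := Real.one_lt_rpow (by norm_num) hs.1
  set c : ℝ := min (k * (q - 1)) (g d / (3*d/2)^s) with hcdef
  have hgd : 0 < g d := hpos d ⟨hd, by linarith⟩
  have hc : 0 < c := lt_min (mul_pos hkp (by linarith)) (by positivity)
  have ind : ∀ n : ℕ, ∀ x, 0 < x → d ≤ (3/2:ℝ)^n * x → x ≤ 3*d/2 → c * x ^ s ≤ g x := by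
    intro n
    induction n with
    | zero =>
      intro x hx h1 h2
      have h1' : d ≤ x := by simpa using h1
      have : x ^ s ≤ (3*d/2)^s := Real.rpow_le_rpow hx.le h2 hs.1.le
      calc c * x ^ s ≤ g d / (3*d/2)^s * (3*d/2)^s :=
            mul_le_mul (min_le_right _ _) this (by positivity) (by positivity)
        _ = g d := by field_simp
        _ ≤ g x := hgm ⟨hd.le, by linarith⟩ ⟨hx.le, by linarith⟩ h1'
    | succ n ih =>
      intro x hx h1 h2
      rcases le_or_gt d x with hdx | hdx
      · exact ih x hx (by nlinarith [one_le_pow₀ (show (1:ℝ) ≤ 3/2 by norm_num) (n := n)]) h2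
      have h3 := ih (3*x/2) (by linarith) (by rw [pow_succ] at h1; linarith) (by linarith)
      have h4 : (3*x/2)^s = q * x ^ s := by
        rw [hq, ← Real.mul_rpow (by norm_num) hx.le]; ring_nf
      rw [h4] at h3
      have h5 := hrec x hx hdx.le
      by_contra! hlt
      have hX : 0 < x ^ s := by positivity
      have hgx : 0 < g x := hpos x ⟨hx, by linarith⟩
      have hck : c ≤ k * (q-1) := min_le_left _ _
      have h6 : g x ^ 2 < (c * x ^ s) ^ 2 := pow_lt_pow_left₀ hlt hgx.le (by norm_num)
      have h7 : c * x ^ s * (q - 1) ≤ g (3*x/2) - g x := by nlinarith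
      have h8 : k * x ^ s * (c * x ^ s * (q - 1)) ≤ k * x ^ s * (g (3*x/2) - g x) :=
        mul_le_mul_of_nonneg_left h7 (by positivity)
      have h9 : c * (c * x ^ s * x ^ s) ≤ k * (q-1) * (c * x ^ s * x ^ s) := mul_le_mul_of_nonneg_right hck (by positivity)
      nlinarith
  refine ⟨c, d, hc, hd, fun x hx hxd => ?_⟩
  obtain ⟨n, hn⟩ := pow_unbounded_of_one_lt (d/x) (show (1:ℝ) < 3/2 by norm_num)
  exact ind n x hx (by rw [div_lt_iff₀ hx] at hn; exact hn.le) (by linarith)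

lemma u_upper {s U L A : ℝ} (hs : s ∈ Ioo (0:ℝ) 1) (hU : 0 < U) (hL : 0 < L) (hA : 0 < A) {u : ℝ → ℝ}
    (hu0 : ∀ x, 0 ≤ u x) (huU : ∀ x, u x ≤ U) (hz : u 0 = 0)
    (hin : ∀ B α, 0 ≤ B → 0 ≤ α → α ≤ s → (∀ z, u z ≤ B * |z| ^ α) →
      ∀ x, x ≠ 0 → u x ^ 2 ≤ 3 * A * L * B * |x| ^ (s + α)) :
    ∃ C, 0 < C ∧ ∀ x, u x ≤ C * |x| ^ s := by
  set C := max (3 * A * L) U with hC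
  have hCp : 0 < C := lt_max_of_lt_right hU
  set α : ℕ → ℝ := fun n => s * (1 - (1/2)^n) with hα
  have hα0 : ∀ n, 0 ≤ α n := fun n => mul_nonneg hs.1.le (sub_nonneg.2 (pow_le_one₀ (by norm_num) (by norm_num)))
  have hαs : ∀ n, α n ≤ s := fun n => by
    have : (0:ℝ) < (1/2)^n := by positivity
    simp only [hα]; nlinarith [hs.1]
  have ind : ∀ n, ∀ x, u x ≤ C * |x| ^ (α n) := by
    intro n
    induction n with
    | zero =>
      intro x
      simp only [hα, pow_zero, sub_self, mul_zero, Real.rpow_zero, mul_one]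
      exact (huU x).trans (le_max_right _ _)
    | succ n ih =>
      intro x
      rcases eq_or_ne x 0 with rfl | hx
      · rw [hz]; positivity
      have h1 := hin C (α n) hCp.le (hα0 n) (hαs n) ih x hx
      have hx' := abs_pos.2 hx
      have e : |x| ^ (s + α n) = (|x| ^ α (n+1)) ^ 2 := by
        rw [← Real.rpow_natCast, ← Real.rpow_mul hx'.le]
        congr 1
        simp only [hα, pow_succ]; push_cast; ring
      refine (pow_le_pow_iff_left₀ (hu0 x) (by positivity) two_ne_zero).1 ?_
      rw [mul_pow, ← e]
      refine h1.trans (mul_le_mul_of_nonneg_right ?_ (by positivity))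
      rw [pow_two]
      exact mul_le_mul_of_nonneg_right (le_max_left _ _) hCp.le
  refine ⟨C, hCp, fun x => ?_⟩
  rcases eq_or_ne x 0 with rfl | hx
  · rw [hz]; positivity
  have hx' := abs_pos.2 hx
  have hlim : Filter.Tendsto α Filter.atTop (nhds s) := by
    have := (tendsto_pow_atTop_nhds_zero_of_lt_one (show (0:ℝ) ≤ 1/2 by norm_num) (by norm_num)).const_sub 1 |>.const_mul s
    simpa [hα] using this
  have h2 : Filter.Tendsto (fun n => C * |x| ^ α n) Filter.atTop (nhds (C * |x| ^ s)) :=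
    ((Real.continuousAt_const_rpow hx'.ne').tendsto.comp hlim).const_mul C
  exact ge_of_tendsto' h2 fun n => ind n x

end FDP

namespace FDP

lemma u_holder {s P c C D : ℝ} (hs : s ∈ Ioo (0:ℝ) 1) (hP : 0 < P) (hc : 0 < c) (hC : 0 < C) (hD : 0 < D)
    {u : ℝ → ℝ} (hu0 : ∀ x, 0 ≤ u x) (hue : ∀ x, u (-x) = u x) (hup : Function.Periodic u P)
    (hup' : ∀ x, u x ≤ C * |x| ^ s) (hlo : ∀ x, 0 < x → x ≤ P/2 → c * x ^ s ≤ u x)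
    (hd : ∀ x y, 0 ≤ x → x ≤ y → 0 < y → |u y ^ 2 - u x ^ 2| ≤ D * ((y - x) ^ s * y ^ s)) :
    ∃ K, ∀ x y, |u x - u y| ≤ K * |x - y| ^ s := by
  have hs0 := hs.1
  set K := max (C * 3 ^ s) (2 * D / c) with hK
  have core : ∀ x y, 0 ≤ x → x ≤ P/2 → |u x - u y| ≤ K * |x - y| ^ s := by
    intro x y hx hxP
    set r := |x - y| with hr
    have hr0 : 0 ≤ r := abs_nonneg _
    have hrs : 0 ≤ r ^ s := Real.rpow_nonneg hr0 s
    rcases le_or_gt x (2 * r) with h | h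
    · have hb : ∀ z, |z| ≤ 3 * r → u z ≤ C * 3 ^ s * r ^ s := by
        intro z hz
        refine (hup' z).trans ?_
        rw [mul_assoc, ← Real.mul_rpow (by norm_num) hr0]
        exact mul_le_mul_of_nonneg_left (Real.rpow_le_rpow (abs_nonneg _) hz hs0.le) hC.le
      have b1 := hb x (by rw [abs_of_nonneg hx]; linarith)
      have b2 := hb y (by
        have := abs_sub_abs_le_abs_sub y x
        rw [abs_sub_comm, abs_of_nonneg hx] at this; linarith)
      have : |u x - u y| ≤ C * 3 ^ s * r ^ s := abs_le.2 ⟨by linarith [hu0 x], by linarith [hu0 y]⟩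
      exact this.trans (mul_le_mul_of_nonneg_right (le_max_left _ _) hrs)
    · have hx0 : 0 < x := by linarith
      have hxs : 0 < x ^ s := by positivity
      have hab := abs_le.1 (le_of_eq hr.symm)
      have h2x : (2 * x) ^ s ≤ 2 * x ^ s := by
        rw [Real.mul_rpow (by norm_num) hx]
        refine mul_le_mul_of_nonneg_right ?_ hxs.le
        calc (2:ℝ) ^ s ≤ 2 ^ (1:ℝ) := Real.rpow_le_rpow_of_exponent_le (by norm_num) hs.2.le
          _ = 2 := Real.rpow_one 2
      have key : |u x ^ 2 - u y ^ 2| ≤ D * (r ^ s * (2 * x ^ s)) := by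
        rcases le_total x y with hxy | hxy
        · have := hd x y hx hxy (by linarith)
          rw [abs_sub_comm] at this
          have e : r = y - x := by rw [hr, abs_sub_comm, abs_of_nonneg (by linarith)]
          rw [e]
          refine this.trans ?_
          rw [e] at hrs hab h
          have h1 : y ^ s ≤ 2 * x ^ s := (Real.rpow_le_rpow (by linarith) (by linarith) hs0.le).trans h2x
          gcongr
        · have := hd y x (by linarith) hxy (by linarith)
          have e : r = x - y := by rw [hr, abs_of_nonneg (by linarith)]
          rw [e]
          refine this.trans ?_
          rw [e] at hrs
          have h1 : x ^ s ≤ 2 * x ^ s := by linarith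
          gcongr
      have hl := hlo x hx0 hxP
      have h3 : |u x - u y| * (c * x ^ s) ≤ |u x ^ 2 - u y ^ 2| := by
        rw [show u x ^ 2 - u y ^ 2 = (u x - u y) * (u x + u y) by ring, abs_mul,
          abs_of_nonneg (add_nonneg (hu0 x) (hu0 y))]
        exact mul_le_mul_of_nonneg_left (by linarith [hu0 y]) (abs_nonneg _)
      have h4 : |u x - u y| * (c * x ^ s) ≤ (2 * D / c * r ^ s) * (c * x ^ s) := by
        refine (h3.trans key).trans (le_of_eq ?_)
        field_simp
      exact (le_of_mul_le_mul_right h4 (by positivity)).trans (mul_le_mul_of_nonneg_right (le_max_right _ _) hrs)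
  refine ⟨K, fun x y => ?_⟩
  set n := round (x / P) with hn
  have h1 : |x - n * P| ≤ P/2 := by
    have := abs_sub_round (x / P)
    rw [show x - n * P = (x / P - n) * P by field_simp, abs_mul, abs_of_pos hP]
    nlinarith
  have e1 : u (x - n * P) = u x := hup.sub_int_mul_eq n
  have e2 : u (y - n * P) = u y := hup.sub_int_mul_eq n
  have h2 := abs_le.1 h1
  rcases le_total 0 (x - n * P) with h | h
  · have := core (x - n * P) (y - n * P) h h2.2
    rwa [e1, e2, show x - n * P - (y - n * P) = x - y by ring] at this
  · have := core (-(x - n * P)) (-(y - n * P)) (by linarith) (by linarith)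
    rw [hue, hue, e1, e2, show -(x - n * P) - -(y - n * P) = y - x by ring, abs_sub_comm y x] at this
    exact this

lemma anti_half {P : ℝ} (hP : 0 < P) {φ : ℝ → ℝ} (hc : Continuous φ) (he : ∀ x, φ (-x) = φ x)
    (hm : MonotoneOn φ (Ioo (-(P/2)) 0)) : AntitoneOn φ (Icc 0 (P/2)) := by
  intro a ha b hb hab
  -- approximate by interior points
  set T : ℝ → ℝ → ℝ := fun t x => (1 - t) * x + t * (P/4) with hT
  have hin : ∀ t ∈ Ioo (0:ℝ) 1, ∀ x ∈ Icc 0 (P/2), T t x ∈ Ioo 0 (P/2) := by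
    intro t ht x hx
    have h1 : 0 ≤ (1 - t) * x := mul_nonneg (by linarith [ht.2]) hx.1
    have h2 : 0 < t * (P/4) := mul_pos ht.1 (by linarith)
    have h3 : 0 ≤ (1 - t) * (P/2 - x) := mul_nonneg (by linarith [ht.2]) (by linarith [hx.2])
    constructor <;> simp only [hT] <;> nlinarith
  have hev : ∀ᶠ t in nhdsWithin (0:ℝ) (Ioi 0), φ (T t b) ≤ φ (T t a) := by
    filter_upwards [Ioo_mem_nhdsGT (show (0:ℝ) < 1 by norm_num)] with t ht
    have h1 := hin t ht a ha
    have h2 := hin t ht b hb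
    have h3 : T t a ≤ T t b := by
      simp only [hT]; nlinarith [ht.2]
    rw [← he (T t b), ← he (T t a)]
    exact hm ⟨by linarith [h2.2], by linarith [h2.1]⟩ ⟨by linarith [h1.2], by linarith [h1.1]⟩ (by linarith)
  have lim : ∀ x, Filter.Tendsto (fun t => φ (T t x)) (nhdsWithin (0:ℝ) (Ioi 0)) (nhds (φ x)) := by
    intro x
    have : Continuous fun t => φ (T t x) := by simp only [hT]; fun_prop
    have h := this.tendsto 0
    simp only [hT] at h ⊢
    simp only [sub_zero, one_mul, zero_mul, add_zero] at h
    exact h.mono_left nhdsWithin_le_nhds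
  exact le_of_tendsto_of_tendsto (lim b) (lim a) hev

end FDP

namespace FDP

theorem main (s μ κ P : ℝ) (hs : s ∈ Set.Ioo (0 : ℝ) 1)
    (hμ : 0 < μ) (hP : 0 < P) (φ : ℝ → ℝ) (hφ : IsFDPSolution s μ κ φ)
    (heven : ∀ x, φ (-x) = φ x) (hper : Function.Periodic φ P)
    (hnc : ∃ x y, φ x ≠ φ y) (hmono : MonotoneOn φ (Set.Ioo (-(P / 2)) 0))
    (hle : ∀ x, φ x ≤ μ) (hmax : φ 0 = μ) :
    (∃ C, ∀ x y, |φ x - φ y| ≤ C * |x - y| ^ s) ∧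
      ∃ c C δ, 0 < c ∧ 0 < C ∧ 0 < δ ∧
        ∀ x : ℝ, |x| ≤ δ → c * |x| ^ s ≤ μ - φ x ∧ μ - φ x ≤ C * |x| ^ s := by
  obtain ⟨hc, ⟨M, hM⟩, hEq⟩ := hφ
  have hs0 := hs.1
  have ha := anti_half hP hc heven hmono
  have h0I : (0:ℝ) ∈ Icc 0 (P/2) := ⟨le_rfl, by linarith⟩
  have hPI : P/2 ∈ Icc 0 (P/2) := ⟨by linarith, le_rfl⟩
  have hM0 : 0 ≤ M := (abs_nonneg _).trans (hM 0)
  have heq : ∀ x, (μ - φ x)^2 = 3 * ((∫ y, besselKernel s (0 - y) * φ y ^ 2) -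
      ∫ y, besselKernel s (x - y) * φ y ^ 2) := by
    intro x
    have h1 := hEq x
    have h2 := hEq 0
    rw [hmax] at h2
    linear_combination 2 * h1 - 2 * h2
  have hm1 := step1 hs hμ hP hc hM heven hper ha hle heq
  set m := φ (P/2) with hm
  -- reduction of points to the half period
  have hred : ∀ x, ∃ x' ∈ Icc 0 (P/2), φ x' = φ x := by
    intro x
    set n := round (x / P) with hn
    have h1 : |x - n * P| ≤ P/2 := by
      have := abs_sub_round (x / P)
      rw [show x - n * P = (x / P - n) * P by field_simp, abs_mul, abs_of_pos hP]
      nlinarith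
    have e1 : φ (x - n * P) = φ x := hper.sub_int_mul_eq n
    refine ⟨|x - n * P|, ⟨abs_nonneg _, h1⟩, ?_⟩
    rcases abs_cases (x - n * P) with ⟨h, _⟩ | ⟨h, _⟩ <;> rw [h]
    · exact e1
    · rw [heven, e1]
  have hmin : ∀ x, m ≤ φ x := by
    intro x
    obtain ⟨x', hx', e⟩ := hred x
    rw [← e]; exact ha hx' hPI hx'.2
  have hm2 : m < μ := by
    refine lt_of_le_of_ne (hle _) fun h => ?_
    obtain ⟨x, y, hxy⟩ := hnc
    exact hxy (by linarith [hmin x, hmin y, hle x, hle y, le_antisymm (hle x) (h ▸ hmin x), le_antisymm (hle y) (h ▸ hmin y)])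
  set u : ℝ → ℝ := fun x => μ - φ x with hu
  have hu0 : ∀ x, 0 ≤ u x := fun x => sub_nonneg.2 (hle x)
  have hu2 : ∀ x, u x < 2 * μ := fun x => by simp only [hu]; linarith [hmin x]
  set h : ℝ → ℝ := fun x => μ ^ 2 - φ x ^ 2 with hh
  have hhu : ∀ x, h x = u x * (2 * μ - u x) := fun x => by simp only [hh, hu]; ring
  have hh0 : ∀ x, 0 ≤ h x := fun x => by
    rw [hhu]; exact mul_nonneg (hu0 x) (by linarith [hu2 x])
  have hhle : ∀ x, h x ≤ 2 * μ * u x := fun x => by rw [hhu]; nlinarith [hu0 x]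
  have hhc : Continuous h := by fun_prop
  have hhM : ∀ x, |h x| ≤ μ ^ 2 := fun x => by
    rw [abs_of_nonneg (hh0 x)]; simp only [hh]; linarith [sq_nonneg (φ x)]
  have hhe : ∀ x, h (-x) = h x := fun x => by simp only [hh, heven]
  have hhp : Function.Periodic h P := fun x => by simp only [hh]; rw [hper]
  have hueq : ∀ x, u x ^ 2 = 3 * ((∫ y, besselKernel s (x - y) * h y) - ∫ y, besselKernel s (0 - y) * h y) := by
    have hH : ∀ x, (∫ y, besselKernel s (x - y) * φ y ^ 2) + (∫ y, besselKernel s (x - y) * h y) = μ ^ 2 := by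
      intro x
      rw [← cv_add hs0 (by fun_prop : Continuous fun y => φ y ^ 2) (M := M ^ 2) _ hhc hhM]
      · simp only [hh]
        refine Eq.trans ?_ (cv_const hs0 (μ ^ 2) x)
        congr 1; funext y; ring_nf
      · intro z
        rw [abs_pow]
        exact pow_le_pow_left₀ (abs_nonneg _) (hM z) 2
    intro x
    have h1 := hH x
    have h2 := hH 0
    simp only [hu]
    rw [heq x]; linarith
  -- upper bound
  obtain ⟨A, hA, hconv⟩ := conv_est hs
  have hconv' : ∀ B α, 0 ≤ B → 0 ≤ α → α ≤ s → (∀ z, u z ≤ B * |z| ^ α) →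
      ∀ x y, 0 ≤ x → x ≤ y → 0 < y → |u y ^ 2 - u x ^ 2| ≤ 3 * A * (2 * μ) * B * ((y - x) ^ s * y ^ α) := by
    intro B α hB hα hαs hb x y hx hxy hy
    have := hconv h (μ^2) (2 * μ * B) α x y hhc hhM hhe hα hαs (by positivity)
      (fun z => by
        rw [abs_of_nonneg (hh0 z)]
        exact (hhle z).trans (by rw [mul_assoc (2*μ)]; exact mul_le_mul_of_nonneg_left (hb z) (by positivity)))
      hx hxy hy
    rw [hueq x, hueq y, ← mul_sub, sub_sub_sub_cancel_right, abs_mul, abs_of_pos (by norm_num : (0:ℝ) < 3)]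
    calc _ ≤ 3 * (A * (2 * μ * B) * ((y - x) ^ s * y ^ α)) := mul_le_mul_of_nonneg_left this (by norm_num)
      _ = _ := by ring
  have hue : ∀ x, u (-x) = u x := fun x => by simp only [hu, heven]
  have hup : Function.Periodic u P := fun x => by simp only [hu]; rw [hper]
  have huz : u 0 = 0 := by simp only [hu]; rw [hmax]; ring
  have hua : ∀ x, u |x| = u x := fun x => by
    rcases abs_cases x with ⟨h, _⟩ | ⟨h, _⟩ <;> rw [h]
    exact hue x
  obtain ⟨C, hC, hupper⟩ := u_upper (U := 2 * μ) (L := 2 * μ) hs (by positivity) (by positivity) hA hu0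
    (fun x => (hu2 x).le) huz (by
      intro B α hB hα hαs hb x hx
      have := hconv' B α hB hα hαs hb 0 |x| le_rfl (abs_nonneg _) (abs_pos.2 hx)
      rw [huz, hua, sub_zero] at this
      rw [Real.rpow_add (abs_pos.2 hx)]
      refine le_trans (le_abs_self _) ?_
      simpa using this)
  -- truncation
  set τ := μ ^ 2 - m ^ 2 with hτ
  have hτ0 : 0 < τ := by rw [hτ]; nlinarith
  set g : ℝ → ℝ := fun x => min (h x) τ with hg
  have hgc : Continuous g := by fun_prop
  have hg0 : ∀ x, 0 ≤ g x := fun x => le_min (hh0 x) hτ0.le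
  have hgh : ∀ x, g x ≤ h x := fun x => min_le_left _ _
  have hgM : ∀ x, |g x| ≤ μ ^ 2 := fun x => by
    rw [abs_of_nonneg (hg0 x)]; exact (hgh x).trans ((le_abs_self _).trans (hhM x))
  have hge : ∀ x, g (-x) = g x := fun x => by simp only [hg, hhe]
  have hgp : Function.Periodic g P := fun x => by simp only [hg]; rw [hhp]
  have hgm : MonotoneOn g (Icc 0 (P/2)) := by
    intro a haa b hb hab
    have h1 := ha haa hb hab
    have h2 := hmin b
    refine le_min ?_ (min_le_right _ _)
    rcases le_total 0 (φ b) with h3 | h3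
    · refine (min_le_left _ _).trans ?_
      simp only [hh]; nlinarith
    · refine (min_le_right _ _).trans ?_
      simp only [hh, hτ]; nlinarith
  have gz : g 0 = 0 := by
    simp only [hg, hh]; rw [hmax, sub_self]; exact min_eq_left hτ0.le
  have gP : 0 < g (P/2) := by
    simp only [hg, hh]; rw [← hm, ← hτ, min_self]; exact hτ0
  -- small neighbourhood
  obtain ⟨δ, hδ, hδτ, hδμ⟩ : ∃ δ, 0 < δ ∧ (∀ z, |z| ≤ δ → h z ≤ τ) ∧ ∀ z, |z| ≤ δ → u z ≤ μ := by
    have e1 : ∀ᶠ z in nhds (0:ℝ), h z < τ := hhc.continuousAt.eventually_lt continuousAt_const (by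
      simp only [hh]; rw [hmax, sub_self]; exact hτ0)
    have e2 : ∀ᶠ z in nhds (0:ℝ), u z < μ := (by fun_prop : Continuous u).continuousAt.eventually_lt continuousAt_const (by
      rw [huz]; exact hμ)
    obtain ⟨ε, hε, hb⟩ := Metric.eventually_nhds_iff.1 (e1.and e2)
    refine ⟨ε/2, by linarith, fun z hz => ?_, fun z hz => ?_⟩
    · exact (hb (by rw [Real.dist_0_eq_abs]; linarith)).1.le
    · exact (hb (by rw [Real.dist_0_eq_abs]; linarith)).2.le
  have hin : ∀ x, 0 < x → x < δ → 3 * ((∫ y, besselKernel s (x - y) * g y) -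
      ∫ y, besselKernel s (0 - y) * g y) ≤ u x ^ 2 := by
    intro x hx hxδ
    set k : ℝ → ℝ := fun y => h y - g y with hk
    have kc : Continuous k := by fun_prop
    have k0 : ∀ y, 0 ≤ k y := fun y => sub_nonneg.2 (hgh y)
    have kM : ∀ y, |k y| ≤ μ ^ 2 := fun y => by
      rw [abs_of_nonneg (k0 y)]; simp only [hk]; linarith [hg0 y, (le_abs_self _).trans (hhM y)]
    have ht := tail_conv (δ := δ) hs kc kM (fun z => by simp only [hk, hhe, hge]) k0
      (fun z hz => by simp only [hk, hg]; rw [min_eq_left (hδτ z hz), sub_self]) hx hxδ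
    have hsum : ∀ x, ∫ y, besselKernel s (x - y) * h y = (∫ y, besselKernel s (x - y) * g y) + ∫ y, besselKernel s (x - y) * k y := by
      intro x
      rw [← cv_add hs0 hgc hgM kc kM]
      simp only [hk, add_sub_cancel]
    rw [hueq x, hsum, hsum]
    linarith
  have hgpos := g_pos hs hP hδ hgc hgM hge hgp hgm gz gP (u := u) (by
    intro x hx hgx
    have h1 : h x = 0 := by
      rcases min_choice (h x) τ with h2 | h2
      · rw [← h2]; exact hgx
      · exfalso
        have : g x = τ := h2
        linarith
    rw [hhu] at h1
    rcases mul_eq_zero.1 h1 with h3 | h3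
    · exact h3
    · linarith [hu2 x]) hin
  obtain ⟨c, d, hc0, hd, hlow⟩ := g_lower hs hP hδ hμ hgc hgM hge hgp hgm hgpos hu0 (by
    intro x hx hxδ
    have hxa : |x| ≤ δ := by rw [abs_of_pos hx]; exact hxδ.le
    have : g x = h x := min_eq_left (hδτ x hxa)
    rw [this, hhu]
    nlinarith [hδμ x hxa, hu0 x]) hin
  have hug : ∀ x, g x / (2 * μ) ≤ u x := fun x => by
    rw [div_le_iff₀ (by positivity)]; linarith [hgh x, hhle x]
  -- lower bound on the half period
  set d' := min d (P/2) with hd'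
  have hd'0 : 0 < d' := lt_min hd (by linarith)
  have hgd : 0 < g d' := hgpos d' ⟨hd'0, min_le_right _ _⟩
  set c1 := min c (g d' / (P/2)^s) / (2 * μ) with hc1
  have hc10 : 0 < c1 := div_pos (lt_min hc0 (by positivity)) (by positivity)
  have hlo : ∀ x, 0 < x → x ≤ P/2 → c1 * x ^ s ≤ u x := by
    intro x hx hxP
    refine le_trans ?_ (hug x)
    rw [hc1, div_mul_eq_mul_div]
    refine div_le_div_of_nonneg_right ?_ (by positivity)
    have hxs : 0 ≤ x ^ s := by positivity
    rcases le_total x d with hxd | hxd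
    · exact (mul_le_mul_of_nonneg_right (min_le_left _ _) hxs).trans (hlow x hx hxd)
    · have h1 : g d' ≤ g x := hgm ⟨hd'0.le, min_le_right _ _⟩ ⟨hx.le, hxP⟩ ((min_le_left _ _).trans hxd)
      have h2 : x ^ s ≤ (P/2) ^ s := Real.rpow_le_rpow hx.le hxP hs0.le
      calc _ ≤ g d' / (P/2)^s * (P/2)^s := mul_le_mul (min_le_right _ _) h2 hxs (by positivity)
        _ = g d' := by field_simp
        _ ≤ g x := h1
  constructor
  · obtain ⟨K, hK⟩ := u_holder (D := 3 * A * (2 * μ) * C) hs hP hc10 hC (by positivity) hu0 hue hup hupper hlo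
      (hconv' C s hC.le hs0.le le_rfl hupper)
    refine ⟨K, fun x y => ?_⟩
    have := hK x y
    rwa [show u x - u y = -(φ x - φ y) by simp only [hu]; ring, abs_neg] at this
  · refine ⟨c1, C, P/2, hc10, hC, by linarith, fun x hx => ⟨?_, hupper x⟩⟩
    rcases eq_or_ne x 0 with rfl | hx0
    · rw [abs_zero, Real.zero_rpow hs0.ne', mul_zero]; exact hu0 0
    · have := hlo |x| (abs_pos.2 hx0) hx
      rwa [hua] at this

end FDP

/-- Highest fDP traveling waves are globally `s`-Hölder continuous and exactly
`s`-Hölder regular at the crest. -/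
theorem fDP_highest_wave_regularity (s μ κ P : ℝ) (hs : s ∈ Set.Ioo (0 : ℝ) 1)
    (hμ : 0 < μ) (hP : 0 < P) (φ : ℝ → ℝ) (hφ : IsFDPSolution s μ κ φ)
    (heven : ∀ x, φ (-x) = φ x) (hper : Function.Periodic φ P)
    (hnc : ∃ x y, φ x ≠ φ y) (hmono : MonotoneOn φ (Set.Ioo (-(P / 2)) 0))
    (hle : ∀ x, φ x ≤ μ) (hmax : φ 0 = μ) :
    (∃ C, ∀ x y, |φ x - φ y| ≤ C * |x - y| ^ s) ∧
      ∃ c C δ, 0 < c ∧ 0 < C ∧ 0 < δ ∧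
        ∀ x : ℝ, |x| ≤ δ → c * |x| ^ s ≤ μ - φ x ∧ μ - φ x ≤ C * |x| ^ s := by
  exact FDP.main s μ κ P hs hμ hP φ hφ heven hper hnc hmono hle hmax
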